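/- Let n ∈ ℕ with 3 ∣ n. Then H_{2,0,3}(n) = −δ_{n=□}·n^{3/2} − 54·δ_{9∣n}·∑_{d∣(n/9), d²<n/9} d³ + 2n·σ(n/3) − 6n·δ_{9∣n}·∑_{d∣(n/9), d²<n/9} d − n^{3/2}·δ_{n=□}. -/

import Mathlib

open scoped BigOperators

namespace HurwitzPaper

/-- Evaluation of the binary quadratic form `(a,b,c)` (i.e. `a x² + b x y + c y²`). -/
def formEval (Q : ℤ × ℤ × ℤ) (x y : ℤ) : ℤ :=
  Q.1 * x ^ 2 + Q.2.1 * x * y + Q.2.2 * y ^ 2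

/-- Discriminant `b² - 4ac` of the form `(a,b,c)`. -/
def formDisc (Q : ℤ × ℤ × ℤ) : ℤ := Q.2.1 ^ 2 - 4 * Q.1 * Q.2.2

/-- Right action of `γ ∈ SL₂(ℤ)` on a binary quadratic form: `(Q∘γ)(x,y) = Q(ax+by, cx+dy)`. -/
def formAct (γ : Matrix.SpecialLinearGroup (Fin 2) ℤ) (Q : ℤ × ℤ × ℤ) : ℤ × ℤ × ℤ :=
  (formEval Q (γ.1 0 0) (γ.1 1 0),
   formEval Q (γ.1 0 0 + γ.1 0 1) (γ.1 1 0 + γ.1 1 1)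
     - formEval Q (γ.1 0 0) (γ.1 1 0) - formEval Q (γ.1 0 1) (γ.1 1 1),
   formEval Q (γ.1 0 1) (γ.1 1 1))

/-- A form is positive definite iff its leading coefficient is positive and its
discriminant is negative. -/
def IsPosDef (Q : ℤ × ℤ × ℤ) : Prop := 0 < Q.1 ∧ formDisc Q < 0

/-- `SL₂(ℤ)`-equivalence classes of positive definite integral binary quadratic forms
of discriminant `-N`. -/
abbrev FormClasses (N : ℤ) :=
  Quot (fun (Q Q' : {Q : ℤ × ℤ × ℤ // formDisc Q = -N ∧ IsPosDef Q}) =>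
    ∃ γ : Matrix.SpecialLinearGroup (Fin 2) ℤ, formAct γ Q.1 = Q'.1)

/-- The Hurwitz class number `H(N)`: each class of positive definite forms of
discriminant `-N` is counted with weight `1/ω_Q = 2/#Γ_Q`, where `Γ_Q` is the stabilizer
of (a representative of) the class in `SL₂(ℤ)`; `H(0) = -1/12`, and `H(N) = 0` when no
such forms exist (in particular for `N < 0` and `N ≡ 1, 2 (mod 4)`). -/
noncomputable def hurwitzClassNumber (N : ℤ) : ℝ :=
  if N = 0 then -(1 / 12)
  else ∑ᶠ c : FormClasses N,
    (2 : ℝ) / (Nat.card {γ : Matrix.SpecialLinearGroup (Fin 2) ℤ //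
      formAct γ c.out.1 = c.out.1})

/-- `H_{κ,m,M}(n) = ∑_{t ≡ m (mod M)} t^κ H(4n - t²)`. -/
noncomputable def HH (κ : ℕ) (m : ℤ) (M : ℕ) (n : ℕ) : ℝ :=
  ∑ᶠ t : ℤ, if t % (M : ℤ) = m % (M : ℤ) then
    (t : ℝ) ^ κ * hurwitzClassNumber (4 * n - t ^ 2) else 0

/-- `a(n)`: the `n`-th Fourier coefficient of `η(3τ)⁸ = q ∏_{k≥1} (1-q^{3k})⁸`
(the factors with `k > n` do not affect the coefficient of `q^n`). -/
noncomputable def etaCoeff (n : ℕ) : ℤ :=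
  Polynomial.coeff (Polynomial.X * ∏ k ∈ Finset.Icc 1 n, (1 - Polynomial.X ^ (3 * k)) ^ 8 : Polynomial ℤ) n



/-! ### The certificate -/

/-- Twice the half-step function. -/
def zg (t : ℤ) : ℕ := if 0 < t then 2 else if t = 0 then 1 else 0

/-- Sparse rows (gate, monomial, coefficient) of the potential. -/
def rowsK : ℕ → List (ℕ × ℕ × ℤ)
  | 0 => [(0, 1, 52), (1, 1, -44), (1, 5, 12), (1, 6, -12), (3, 9, -12), (4, 3, 4), (4, 8, 8),
      (5, 0, 24), (5, 1, 4), (5, 3, 48), (5, 4, 24), (5, 5, 12), (5, 6, 36), (5, 9, 12), (6, 0,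
      -12), (6, 2, -12), (6, 8, -8), (7, 6, 12)]
  | 1 => [(2, 3, -4), (4, 0, -12), (4, 1, -8), (4, 3, -8), (6, 2, 36), (6, 5, 12), (6, 7, 24),
      (6, 8, 8), (7, 1, -4), (7, 3, -4), (7, 8, -16), (7, 9, -12)]
  | 2 => [(4, 1, -8), (4, 8, 8), (6, 0, -12), (6, 1, 4), (6, 2, -12), (6, 3, -12), (6, 6, 12),
      (6, 8, -4), (7, 2, 12), (7, 3, -8), (7, 8, 8)]
  | 3 => [(4, 4, -6), (4, 7, 6), (6, 0, -12), (6, 1, -4), (6, 2, -12), (6, 3, -16), (6, 6, 12),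
      (6, 8, -4), (7, 2, 12)]
  | 4 => [(4, 1, 8), (4, 3, -8), (4, 8, -8), (6, 0, 36), (6, 1, -8), (6, 2, 60), (6, 5, -12),
      (6, 7, 24)]
  | 5 => [(1, 3, -8), (2, 1, -4), (4, 1, -8), (4, 2, -12), (4, 4, -6), (4, 7, -6), (4, 8, -4),
      (5, 3, -8), (6, 0, 12), (6, 2, 12), (6, 5, -12), (6, 7, 12), (6, 8, 4), (7, 1, -4), (7, 3,
      -4), (7, 8, 4)]
  | 6 => [(4, 7, -12), (6, 0, 12), (6, 2, 24), (7, 8, -4), (7, 9, -12)]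
  | 7 => [(0, 1, 12), (1, 0, -12), (1, 1, -20), (1, 2, -12), (1, 3, -8), (1, 8, -8), (3, 1, -8),
      (3, 6, -24), (4, 2, -12), (4, 5, -24), (4, 7, -12), (5, 0, 12), (5, 1, 20), (5, 2, -12),
      (5, 3, 40), (5, 4, 24), (5, 6, 24), (5, 8, -8), (5, 9, 24), (7, 0, 12), (7, 2, 12)]
  | 8 => [(4, 1, 4), (4, 4, 6), (4, 6, 12), (4, 7, 6), (4, 8, 4), (6, 2, -12), (6, 3, 8), (7, 1,
      4), (7, 5, -12), (7, 6, 12)]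
  | 9 => [(1, 3, -8), (3, 1, -4), (3, 3, -8), (4, 1, 4), (4, 8, -8), (5, 0, 24), (5, 1, 44), (5,
      3, 32), (5, 4, 24), (5, 6, 48), (5, 9, 24), (6, 0, 36), (6, 2, 48), (6, 7, 12), (7, 1,
      -28), (7, 3, -16), (7, 5, -12), (7, 8, -4)]
  | 10 => [(0, 1, 8), (1, 6, 12), (4, 4, 12), (5, 6, 12), (7, 3, 8), (7, 6, 12), (7, 8, -16),
      (7, 9, 12)]
  | 11 => [(4, 2, -24), (4, 4, 12), (4, 5, 24), (4, 6, 12), (4, 8, -8), (6, 0, -12), (6, 1, 8),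
      (6, 3, -4), (6, 7, 24)]
  | 12 => [(6, 5, -12), (6, 8, -12)]
  | 13 => [(6, 0, 12), (6, 2, 24), (6, 7, 12), (7, 1, -12), (7, 3, -12), (7, 5, -12)]
  | 14 => [(0, 1, 12), (1, 1, -12), (1, 3, -24), (1, 4, -6), (3, 9, -24), (4, 0, -24), (5, 0,
      24), (5, 1, 36), (5, 3, 24), (5, 4, 18), (5, 6, 48), (6, 2, 36), (6, 7, 18), (6, 8, 24),
      (8, 1, -6)]
  | 15 => [(6, 0, -12), (6, 3, -12), (7, 8, -12), (7, 9, -12)]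
  | 16 => [(0, 1, 84), (1, 0, -12), (1, 1, -40), (1, 2, -12), (1, 3, -48), (1, 4, -6), (1, 5,
      12), (1, 8, -8), (2, 1, -4), (2, 3, -4), (3, 1, -12), (3, 3, -8), (3, 4, 72), (3, 6, -24),
      (3, 9, 36), (4, 0, 36), (4, 1, -8), (4, 2, -48), (4, 3, -12), (4, 6, 24), (4, 7, 72), (4,
      8, -8), (5, 0, 12), (5, 1, -4), (5, 2, -12), (5, 3, -8), (5, 4, 90), (5, 5, 12), (5, 6,
      24), (5, 8, -8), (5, 9, 60), (6, 0, 48), (6, 1, -36), (6, 2, -24), (6, 3, -36), (6, 5,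
      12), (6, 6, 24), (6, 7, 90), (6, 8, 8), (7, 0, 12), (7, 1, -44), (7, 2, 36), (7, 6, -36),
      (7, 8, 32), (7, 9, -24), (8, 1, -6)]
  | _ => []

def gate (g z1 z2 z3 : ℕ) : ℕ :=
  min 4 (match g with
  | 0 => 4
  | 1 => 2 * z1
  | 2 => 2 * z3
  | 3 => z1 * z3
  | 4 => z1 * (Nat.sub 2 z3)
  | 5 => (2 - z1) * z3
  | 6 => (2 - z1) * (Nat.sub 2 z3)
  | 7 => 2 * z2
  | _ => if z1 = 1 ∧ z3 = 1 then 4 else 0)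

def mon (i : ℕ) (x y b c : ℤ) : ℤ :=
  match i with
  | 0 => x * x
  | 1 => x * y
  | 2 => x * b
  | 3 => x * c
  | 4 => y * y
  | 5 => y * b
  | 6 => y * c
  | 7 => b * b
  | 8 => b * c
  | _ => c * c

def rowV (g : ℕ) (r : ℕ × ℤ) (x y b c : ℤ) : ℤ :=
  g.casesOn 0 fun k => Int.mul (Int.mul (Int.ofNat (Nat.succ k)) r.2) (mon r.1 x y b c)

def phiL (z1 z2 z3 : ℕ) (x y b c : ℤ) (l : List (ℕ × ℕ × ℤ)) : ℤ :=
  List.rec (motive := fun _ => ℤ) 0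
    (fun r _ ih => Int.add (rowV (gate r.1 z1 z2 z3) r.2 x y b c) ih) l

/-- index of the line spanned by a nonzero vector mod 3 -/
def lineC (u v : ℕ) : ℕ := if v = 0 then 0 else if u = 0 then 1 else if u = v then 2 else 3

def lineR (u v : ℕ) : ℕ := if v = 0 then 1 else if u = 0 then 0 else if u = v then 3 else 2

def stt (a b c d : ℕ) : ℕ :=
  if a = 0 ∧ b = 0 then
    if c = 0 ∧ d = 0 then 16 else 4 * lineR c d + 1
  else 4 * lineR a b + (if a = 0 ∧ c = 0 then lineC b d else lineC a c)

def rs (t : ℤ) : ℕ := (t % 3).toNat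

/-- The potential. -/
def phi (x y b c : ℤ) : ℤ :=
  phiL (zg (x - y)) (zg (x - c)) (zg (x + b - y - c)) x y b c
    (rowsK (stt (rs x) (rs (-(x + b))) (rs c) (rs y)))

/-- The wall term as a function of comparison code and residues. -/
def rhoG (z : ℕ) (rx ry rc : ℕ) (x y c : ℤ) : ℤ :=
  (if rx = 0 then 4 * (6 * x * x) + 2 * (z : ℤ) * (-6 * x * (x + y + c))
      + (if z = 1 then 4 * (4 * x * x + x * c) else 0) else 0)
  + (if (ry + rc) % 3 = 0 then 4 * (8 * x * y) + 2 * (z : ℤ) * (12 * y * (y + c))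
      + (if z = 1 then 4 * (-2 * x * (x + c)) else 0) else 0)
  + (if rx = 0 ∧ (ry + rc) % 3 = 0 then 4 * (12 * x * x - 8 * x * y)
      + 2 * (z : ℤ) * (-12 * (x * (x + c)) - 12 * (y * (y + c)))
      + (if z = 1 then 4 * (4 * x * (x + c)) else 0) else 0)
  + (if rx = 0 ∧ ry = 0 ∧ rc = 0 then 4 * (24 * x * y) else 0)

def rho (x y c : ℤ) : ℤ := rhoG (zg (x - y)) (rs x) (rs y) (rs c) x y c

def f3 (s : ℤ) : ℤ := if rs s = 0 then s * s else 0

structure Cmp where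
  g1 : ℕ
  g2 : ℕ
  a1 : ℕ
  a2 : ℕ
  a3 : ℕ
  v : ℕ
  u1 : ℕ
  u2 : ℕ
  u3 : ℕ
  u4 : ℕ

def cmpOf (x y B c : ℤ) : Cmp :=
  ⟨zg (B - x), zg (y - c), zg (x - y), zg (x - c), zg (B - y - c), zg (B - c),
    zg (x - y - B), zg (y - x - B), zg (x - y - c), zg (y - x - c)⟩

def w1C (C : Cmp) : ℤ :=
  if C.u1 = 2 ∨ C.u2 = 2 ∨ C.u3 = 2 ∨ C.u4 = 2 then 0
  else if C.u1 = 1 ∨ C.u2 = 1 ∨ C.u3 = 1 ∨ C.u4 = 1 then (if C.v = 1 then 2 else 3)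
  else 6

def w2C (C : Cmp) : ℤ :=
  if C.v = 0 ∨ C.g1 ≠ 0 ∨ C.u1 = 2 then 0
  else if C.v = 1 then (if C.u1 = 1 then 2 else 3) else (if C.u1 = 1 then 3 else 6)

def preG (C : Cmp) (rx ry rB rc : ℕ) (x y B c : ℤ) : ℤ :=
  if C.g1 = 2 then phiL C.a1 C.a2 C.a3 x y (B - x) c (rowsK (stt rx ((2 * rB) % 3) rc ry)) else 0

def postG (C : Cmp) (rx ry rB rc : ℕ) (x y B c : ℤ) : ℤ :=
  if C.g2 = 2 then phiL (2 - C.u4) C.a2 (2 - C.u2) x (y - c) B c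
    (rowsK (stt rx ((2 * (rx + rB)) % 3) rc ((ry + 2 * rc) % 3))) else 0

def wallG (C : Cmp) (rx ry rc : ℕ) (x y c : ℤ) : ℤ :=
  if C.g1 = 1 then rhoG C.a1 rx ry rc x y c - (if ry = 0 then 24 * (C.a1 : ℤ) * (y * y) else 0)
  else 0

def gwG (C : Cmp) (rx ry rB rc : ℕ) (x y B c : ℤ) : ℤ :=
  (if (rx + ry) % 3 = 0 then w1C C * ((x + y) * (x + y)) else 0)
  + (if (rc + rB + 2 * rx) % 3 = 0 then w2C C * ((c + B - x) * (c + B - x)) else 0)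

def tG (C : Cmp) (rx ry rB rc : ℕ) (x y B c : ℤ) : ℤ :=
  preG C rx ry rB rc x y B c - postG C rx ry rB rc x y B c + wallG C rx ry rc x y c
    - 4 * gwG C rx ry rB rc x y B c

def tZ (x y B c : ℤ) : ℤ := tG (cmpOf x y B c) (rs x) (rs y) (rs B) (rs c) x y B c

def t8Z (x y B c : ℤ) : ℤ :=
  tZ x y B c + tZ y x B c + tZ x y c B + tZ y x c B
  + tZ B c x y + tZ c B x y + tZ B c y x + tZ c B y x

/-- the symmetrised certificate, from the nine signs -/
def t8G (s1 s2 s3 s4 s5 s6 s7 s8 s9 : ℕ) (rx ry rB rc : ℕ) (x y B c : ℤ) : ℤ :=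
  tG ⟨2 - s2, s5, s1, s3, s9, s6, s7, 0, s8, 0⟩ rx ry rB rc x y B c
  + tG ⟨2 - s4, s3, 2 - s1, s5, 0, s6, 0, s7, 0, s8⟩ ry rx rB rc y x B c
  + tG ⟨2 - s3, s4, s1, s2, 0, 2 - s6, s8, 0, s7, 0⟩ rx ry rc rB x y c B
  + tG ⟨2 - s5, s2, 2 - s1, s4, 0, 2 - s6, 0, s8, 0, s7⟩ ry rx rc rB y x c B
  + tG ⟨s2, 2 - s5, s6, 2 - s4, s8, s1, 0, 0, s9, 0⟩ rB rc rx ry B c x y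
  + tG ⟨s3, 2 - s4, 2 - s6, 2 - s5, s7, s1, 0, 0, 0, s9⟩ rc rB rx ry c B x y
  + tG ⟨s4, 2 - s3, s6, 2 - s2, 0, 2 - s1, s9, 0, 0, 0⟩ rB rc ry rx B c y x
  + tG ⟨s5, 2 - s2, 2 - s6, 2 - s3, 0, 2 - s1, 0, s9, 0, 0⟩ rc rB ry rx c B y x

def subB (s4 s6 s9 : ℕ) (y B c : ℤ) : ℤ :=
  if s9 = 1 then y + c else if s4 = 1 then y else if s6 = 1 then c else B

def subX (s1 s2 s3 s7 s8 : ℕ) (x y B c : ℤ) : ℤ :=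
  if s1 = 1 then y else if s2 = 1 then B else if s3 = 1 then c
  else if s7 = 1 then y + B else if s8 = 1 then y + c else x

def subY (s5 : ℕ) (y c : ℤ) : ℤ := if s5 = 1 then c else y

def t8S (s1 s2 s3 s4 s5 s6 s7 s8 s9 : ℕ) (rx ry rB rc : ℕ) (x y B c : ℤ) : ℤ :=
  t8G s1 s2 s3 s4 s5 s6 s7 s8 s9 rx ry rB rc
    (subX s1 s2 s3 s7 s8 x (subY s5 y c) (subB s4 s6 s9 (subY s5 y c) B c) c)
    (subY s5 y c) (subB s4 s6 s9 (subY s5 y c) B c) c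

def cells : List ℕ :=
  [257, 269, 364, 377, 484, 485, 509, 512, 590, 593, 671, 674, 697, 701, 727, 728, 2699, 2780,
   2861, 2888, 2915, 3185, 3293, 3401, 4886, 4967, 5048, 5075, 5102, 5615, 5696, 5777, 5804,
   5831, 6101, 6209, 6317, 6344, 6425, 6506, 6533, 6560, 9257, 9338, 9419, 11447, 11528, 11609,
   12176, 12257, 12338, 12905, 12986, 13067, 18005, 18008, 18086, 18089, 18167, 18170, 18737,
   18818, 18899, 19466, 19547, 19628]

def resList : List (ℕ × ℕ × ℕ × ℕ) :=
  ((List.range 81).map fun i => (i % 3, i / 3 % 3, i / 9 % 3, i / 27)).filter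
    fun r => (r.1 * r.2.1 + r.2.2.1 * r.2.2.2) % 3 = 0

def KK : ℤ := 10 ^ 9

def consR (s1 s2 s3 s4 s5 s6 s7 s8 s9 : ℕ) (rx ry rB rc : ℕ) : Bool :=
  rs (subX s1 s2 s3 s7 s8 rx ry rB rc) == rx && rs (subY s5 ry rc) == ry &&
    rs (subB s4 s6 s9 ry rB rc) == rB

def chk0 (s1 s2 s3 s4 s5 s6 s7 s8 s9 : ℕ) (rx ry rB rc : ℕ) : Bool :=
  !consR s1 s2 s3 s4 s5 s6 s7 s8 s9 rx ry rB rc ||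
  t8S s1 s2 s3 s4 s5 s6 s7 s8 s9 rx ry rB rc 1 KK (KK ^ 3) (KK ^ 7) == 0

def chk1 (e : ℕ) (r : ℕ × ℕ × ℕ × ℕ) : Bool :=
  chk0 (e % 3) (e / 3 % 3) (e / 9 % 3) (e / 27 % 3) (e / 81 % 3) (e / 243 % 3) (e / 729 % 3)
    (e / 2187 % 3) (e / 6561 % 3) r.1 r.2.1 r.2.2.1 r.2.2.2

def chkAll : Bool := resList.all fun r => cells.all fun e => chk1 e r


theorem chkAll_true : chkAll = true := by decide +kernel

/-! ### Soundness of the certificate check -/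

def IsLin (A : ℤ) (l : ℤ → ℤ → ℤ → ℤ → ℤ) : Prop :=
  ∃ a b c d : ℤ, |a| + |b| + |c| + |d| ≤ A ∧
    ∀ x y z w, l x y z w = a * x + b * y + c * z + d * w

structure QF where
  (q0 q1 q2 q3 q4 q5 q6 q7 q8 q9 : ℤ)

def QF.ev (q : QF) (x y z w : ℤ) : ℤ :=
  q.q0 * (x * x) + q.q1 * (x * y) + q.q2 * (x * z) + q.q3 * (x * w) + q.q4 * (y * y)
    + q.q5 * (y * z) + q.q6 * (y * w) + q.q7 * (z * z) + q.q8 * (z * w) + q.q9 * (w * w)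

def QF.nm (q : QF) : ℤ :=
  |q.q0| + |q.q1| + |q.q2| + |q.q3| + |q.q4| + |q.q5| + |q.q6| + |q.q7| + |q.q8| + |q.q9|

def IsQuad (C : ℤ) (F : ℤ → ℤ → ℤ → ℤ → ℤ) : Prop :=
  ∃ q : QF, q.nm ≤ C ∧ ∀ x y z w, F x y z w = q.ev x y z w

theorem IsLin.mono {A A' l} (h : IsLin A l) (hA : A ≤ A') : IsLin A' l := by
  obtain ⟨a, b, c, d, h1, h2⟩ := h
  exact ⟨a, b, c, d, h1.trans hA, h2⟩

theorem IsQuad.mono {A A' l} (h : IsQuad A l) (hA : A ≤ A') : IsQuad A' l := by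
  obtain ⟨q, h1, h2⟩ := h
  exact ⟨q, h1.trans hA, h2⟩

theorem IsLin.v1 : IsLin 1 (fun x _ _ _ => x) := ⟨1, 0, 0, 0, by norm_num, by intros; ring⟩
theorem IsLin.v2 : IsLin 1 (fun _ y _ _ => y) := ⟨0, 1, 0, 0, by norm_num, by intros; ring⟩
theorem IsLin.v3 : IsLin 1 (fun _ _ z _ => z) := ⟨0, 0, 1, 0, by norm_num, by intros; ring⟩
theorem IsLin.v4 : IsLin 1 (fun _ _ _ w => w) := ⟨0, 0, 0, 1, by norm_num, by intros; ring⟩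

theorem IsLin.add {A B l m} (h : IsLin A l) (k : IsLin B m) :
    IsLin (A + B) (fun x y z w => l x y z w + m x y z w) := by
  obtain ⟨a, b, c, d, h1, h2⟩ := h
  obtain ⟨a', b', c', d', k1, k2⟩ := k
  refine ⟨a + a', b + b', c + c', d + d', ?_, ?_⟩
  · linarith [abs_add_le a a', abs_add_le b b', abs_add_le c c', abs_add_le d d']
  · intros; dsimp only; rw [h2, k2]; ring

theorem IsLin.sub {A B l m} (h : IsLin A l) (k : IsLin B m) :
    IsLin (A + B) (fun x y z w => l x y z w - m x y z w) := by
  obtain ⟨a, b, c, d, h1, h2⟩ := h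
  obtain ⟨a', b', c', d', k1, k2⟩ := k
  refine ⟨a - a', b - b', c - c', d - d', ?_, ?_⟩
  · linarith [abs_sub a a', abs_sub b b', abs_sub c c', abs_sub d d']
  · intros; dsimp only; rw [h2, k2]; ring

theorem IsQuad.add {A B l m} (h : IsQuad A l) (k : IsQuad B m) :
    IsQuad (A + B) (fun x y z w => l x y z w + m x y z w) := by
  obtain ⟨q, h1, h2⟩ := h
  obtain ⟨r, k1, k2⟩ := k
  refine ⟨⟨q.q0 + r.q0, q.q1 + r.q1, q.q2 + r.q2, q.q3 + r.q3, q.q4 + r.q4, q.q5 + r.q5,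
    q.q6 + r.q6, q.q7 + r.q7, q.q8 + r.q8, q.q9 + r.q9⟩, ?_, ?_⟩
  · unfold QF.nm at *
    dsimp only
    linarith [abs_add_le q.q0 r.q0, abs_add_le q.q1 r.q1, abs_add_le q.q2 r.q2,
      abs_add_le q.q3 r.q3, abs_add_le q.q4 r.q4, abs_add_le q.q5 r.q5, abs_add_le q.q6 r.q6,
      abs_add_le q.q7 r.q7, abs_add_le q.q8 r.q8, abs_add_le q.q9 r.q9]
  · intros; dsimp only; rw [h2, k2]; simp only [QF.ev]; ring

theorem IsQuad.smul {A l} (h : IsQuad A l) (t : ℤ) {T : ℤ} (hT : |t| ≤ T) :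
    IsQuad (T * A) (fun x y z w => t * l x y z w) := by
  obtain ⟨q, h1, h2⟩ := h
  refine ⟨⟨t * q.q0, t * q.q1, t * q.q2, t * q.q3, t * q.q4, t * q.q5,
    t * q.q6, t * q.q7, t * q.q8, t * q.q9⟩, ?_, ?_⟩
  · have : 0 ≤ q.nm := by unfold QF.nm; positivity
    calc _ = |t| * q.nm := by simp only [QF.nm, abs_mul]; ring
      _ ≤ T * A := mul_le_mul hT h1 this ((abs_nonneg t).trans hT)
  · intros; dsimp only; rw [h2]; simp only [QF.ev]; ring

theorem IsQuad.neg {A l} (h : IsQuad A l) : IsQuad A (fun x y z w => - l x y z w) := by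
  have := h.smul (-1) (T := 1) (by norm_num)
  simpa using this

theorem IsQuad.sub {A B l m} (h : IsQuad A l) (k : IsQuad B m) :
    IsQuad (A + B) (fun x y z w => l x y z w - m x y z w) := by
  simpa [sub_eq_add_neg] using h.add k.neg

theorem IsQuad.congr {A l m} (h : IsQuad A l) (e : ∀ x y z w, m x y z w = l x y z w) :
    IsQuad A m := by
  obtain ⟨q, h1, h2⟩ := h
  exact ⟨q, h1, fun x y z w => by rw [e, h2]⟩

theorem IsQuad.zero {A : ℤ} (hA : 0 ≤ A) : IsQuad A (fun _ _ _ _ => 0) :=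
  ⟨⟨0, 0, 0, 0, 0, 0, 0, 0, 0, 0⟩, by simpa [QF.nm] using hA, by intros; simp [QF.ev]⟩

theorem IsQuad.ite {A l} (h : IsQuad A l) (p : Prop) [Decidable p] (hA : 0 ≤ A) :
    IsQuad A (fun x y z w => if p then l x y z w else 0) := by
  by_cases hp : p
  · simpa [hp] using h
  · simpa [hp] using IsQuad.zero hA

theorem IsLin.mul {A B l m} (h : IsLin A l) (k : IsLin B m) :
    IsQuad (A * B) (fun x y z w => l x y z w * m x y z w) := by
  obtain ⟨a, b, c, d, h1, h2⟩ := h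
  obtain ⟨a', b', c', d', k1, k2⟩ := k
  refine ⟨⟨a * a', a * b' + b * a', a * c' + c * a', a * d' + d * a', b * b',
    b * c' + c * b', b * d' + d * b', c * c', c * d' + d * c', d * d'⟩, ?_, ?_⟩
  · have e : (|a| + |b| + |c| + |d|) * (|a'| + |b'| + |c'| + |d'|) ≤ A * B :=
      mul_le_mul h1 k1 (by positivity) (le_trans (by positivity) h1)
    refine le_trans ?_ e
    simp only [QF.nm]
    have t (u v : ℤ) (u' v' : ℤ) : |u * v' + v * u'| ≤ |u| * |v'| + |v| * |u'| := by
      rw [← abs_mul, ← abs_mul]; exact abs_add_le _ _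
    simp only [abs_mul]
    linarith [t a b a' b', t a c a' c', t a d a' d', t b c b' c', t b d b' d', t c d c' d']
  · intros; dsimp only; rw [h2, k2]; simp only [QF.ev]; ring

theorem kron1 {K a b : ℤ} (h : a + K * b = 0) (ha : |a| < K) : a = 0 ∧ b = 0 := by
  have hd : K ∣ a := ⟨-b, by linarith⟩
  have h0 : a = 0 := Int.eq_zero_of_abs_lt_dvd hd ha
  refine ⟨h0, ?_⟩
  have hK : 0 < K := lt_of_le_of_lt (abs_nonneg a) ha
  rw [h0, zero_add] at h
  rcases mul_eq_zero.1 h with h | h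
  · omega
  · exact h

theorem IsQuad.eq_zero {C F} (h : IsQuad C F) (hC : C < KK)
    (h0 : F 1 KK (KK ^ 3) (KK ^ 7) = 0) (x y z w : ℤ) : F x y z w = 0 := by
  obtain ⟨q, h1, h2⟩ := h
  rw [h2] at h0 ⊢
  have hb : q.nm < KK := lt_of_le_of_lt h1 hC
  unfold QF.nm at hb
  have p0 := abs_nonneg q.q0
  have p1 := abs_nonneg q.q1
  have p2 := abs_nonneg q.q2
  have p3 := abs_nonneg q.q3
  have p4 := abs_nonneg q.q4
  have p5 := abs_nonneg q.q5
  have p6 := abs_nonneg q.q6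
  have p7 := abs_nonneg q.q7
  have p8 := abs_nonneg q.q8
  have p9 := abs_nonneg q.q9
  have K0 : (0 : ℤ) < KK := by norm_num [KK]
  generalize KK = K at *
  obtain ⟨e0, r⟩ := kron1 (K := K) (a := q.q0) (b := q.q1 + K * (q.q4 + K * (q.q2 + K * (q.q5
    + K * (K * (q.q7 + K * (q.q3 + K * (q.q6 + K * (K * (q.q8 + K * (K * (K * (K * q.q9))))))))))))) 
    (by rw [← h0]; simp only [QF.ev]; ring) (by linarith)
  obtain ⟨e1, r⟩ := kron1 r (by linarith)
  obtain ⟨e4, r⟩ := kron1 r (by linarith)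
  obtain ⟨e2, r⟩ := kron1 r (by linarith)
  obtain ⟨e5, r⟩ := kron1 r (by linarith)
  have r := (mul_eq_zero.1 r).resolve_left K0.ne'
  obtain ⟨e7, r⟩ := kron1 r (by linarith)
  obtain ⟨e3, r⟩ := kron1 r (by linarith)
  obtain ⟨e6, r⟩ := kron1 r (by linarith)
  have r := (mul_eq_zero.1 r).resolve_left K0.ne'
  obtain ⟨e8, r⟩ := kron1 r (by linarith)
  have r := (mul_eq_zero.1 r).resolve_left K0.ne'
  have r := (mul_eq_zero.1 r).resolve_left K0.ne'
  have r := (mul_eq_zero.1 r).resolve_left K0.ne'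
  simp [QF.ev, e0, e1, e2, e3, e4, e5, e6, e7, e8, r]

theorem gate_le (g z1 z2 z3 : ℕ) : gate g z1 z2 z3 ≤ 4 := min_le_left _ _

theorem mon_quad {A lx ly lb lc} (i : ℕ) (hx : IsLin A lx) (hy : IsLin A ly) (hb : IsLin A lb)
    (hc : IsLin A lc) :
    IsQuad (A * A) (fun x y z w => mon i (lx x y z w) (ly x y z w) (lb x y z w) (lc x y z w)) := by
  unfold mon
  split
  · exact hx.mul hx
  · exact hx.mul hy
  · exact hx.mul hb
  · exact hx.mul hc
  · exact hy.mul hy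
  · exact hy.mul hb
  · exact hy.mul hc
  · exact hb.mul hb
  · exact hb.mul hc
  · exact hc.mul hc

def rowsNm (l : List (ℕ × ℕ × ℤ)) : ℤ := (l.map fun r => |r.2.2|).sum

theorem rowsNm_nonneg (l : List (ℕ × ℕ × ℤ)) : 0 ≤ rowsNm l := by
  unfold rowsNm
  apply List.sum_nonneg
  intro x hx
  obtain ⟨r, -, rfl⟩ := List.mem_map.1 hx
  positivity

theorem rowV_eq (g : ℕ) (r : ℕ × ℤ) (x y b c : ℤ) :
    rowV g r x y b c = (g : ℤ) * r.2 * mon r.1 x y b c := by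
  cases g with
  | zero => simp [rowV]
  | succ k => rfl

theorem phiL_quad {A lx ly lb lc} (z1 z2 z3 : ℕ) (l : List (ℕ × ℕ × ℤ))
    (hx : IsLin A lx) (hy : IsLin A ly) (hb : IsLin A lb) (hc : IsLin A lc) :
    IsQuad (4 * rowsNm l * (A * A)) (fun x y z w =>
      phiL z1 z2 z3 (lx x y z w) (ly x y z w) (lb x y z w) (lc x y z w) l) := by
  induction l with
  | nil => exact IsQuad.zero (by simp [rowsNm])
  | cons r l ih =>
    have h1 : |((gate r.1 z1 z2 z3 : ℕ) : ℤ) * r.2.2| ≤ 4 * |r.2.2| := by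
      rw [abs_mul]
      apply mul_le_mul_of_nonneg_right _ (abs_nonneg _)
      rw [abs_of_nonneg (by positivity)]
      exact_mod_cast gate_le _ _ _ _
    have h2 := ((mon_quad r.2.1 hx hy hb hc).smul _ h1).add ih
    have e : 4 * rowsNm (r :: l) * (A * A) = 4 * |r.2.2| * (A * A) + 4 * rowsNm l * (A * A) := by
      simp only [rowsNm, List.map_cons, List.sum_cons]; ring
    rw [e]
    convert h2 using 5
    show Int.add (rowV _ _ _ _ _ _) _ = _
    rw [rowV_eq]
    rfl

theorem rowsK_nm (k : ℕ) : rowsNm (rowsK k) ≤ 1500 := by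
  by_cases hk : k < 17
  · interval_cases k <;> decide +kernel
  · have : rowsK k = [] := by
      unfold rowsK
      split <;> first | omega | rfl
    simp [this, rowsNm]

theorem phiK_quad {A lx ly lb lc} (z1 z2 z3 k : ℕ)
    (hx : IsLin A lx) (hy : IsLin A ly) (hb : IsLin A lb) (hc : IsLin A lc) :
    IsQuad (6000 * (A * A)) (fun x y z w =>
      phiL z1 z2 z3 (lx x y z w) (ly x y z w) (lb x y z w) (lc x y z w) (rowsK k)) := by
  apply (phiL_quad z1 z2 z3 (rowsK k) hx hy hb hc).mono
  nlinarith [rowsK_nm k, mul_self_nonneg A]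

theorem IsLin.nonneg {A l} (h : IsLin A l) : 0 ≤ A := by
  obtain ⟨a, b, c, d, h1, h2⟩ := h
  exact le_trans (by positivity) h1

theorem rhoG_quad {A lx ly lc} (z rx ry rc : ℕ) (hz : z ≤ 2)
    (hx : IsLin A lx) (hy : IsLin A ly) (hc : IsLin A lc) :
    IsQuad (8000 * (A * A)) (fun x y z' w =>
      rhoG z rx ry rc (lx x y z' w) (ly x y z' w) (lc x y z' w)) := by
  have hA := hx.nonneg
  have hAA := mul_self_nonneg A
  have key : ∀ (a0 a1 a2 a3 a4 : ℤ), |a0| + |a1| + |a2| + |a3| + |a4| ≤ 2000 →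
    IsQuad (2000 * (A * A)) (fun x y z' w =>
      a0 * (lx x y z' w * lx x y z' w) + a1 * (lx x y z' w * ly x y z' w)
      + a2 * (lx x y z' w * lc x y z' w) + a3 * (ly x y z' w * ly x y z' w)
      + a4 * (ly x y z' w * lc x y z' w)) := by
    intro a0 a1 a2 a3 a4 h
    apply ((((((hx.mul hx).smul a0 le_rfl).add ((hx.mul hy).smul a1 le_rfl)).add
      ((hx.mul hc).smul a2 le_rfl)).add ((hy.mul hy).smul a3 le_rfl)).add
      ((hy.mul hc).smul a4 le_rfl)).mono
    nlinarith
  have k1 := key (24 - 12 * z + (if z = 1 then 16 else 0)) (-12 * z)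
    (-12 * z + (if z = 1 then 4 else 0)) 0 0 (by interval_cases z <;> norm_num)
  have k2 := key (if z = 1 then -8 else 0) 32 (if z = 1 then -8 else 0) (24 * z) (24 * z)
    (by interval_cases z <;> norm_num)
  have k3 := key (48 - 24 * z + (if z = 1 then 16 else 0)) (-32)
    (-24 * z + (if z = 1 then 16 else 0)) (-24 * z) (-24 * z) (by interval_cases z <;> norm_num)
  have k4 := key 0 96 0 0 0 (by norm_num)
  have hp : 0 ≤ 2000 * (A * A) := by positivity
  have := (((k1.ite (rx = 0) hp).add (k2.ite ((ry + rc) % 3 = 0) hp)).add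
    (k3.ite (rx = 0 ∧ (ry + rc) % 3 = 0) hp)).add (k4.ite (rx = 0 ∧ ry = 0 ∧ rc = 0) hp)
  refine IsQuad.congr (this.mono (by linarith)) ?_
  intro x y z' w
  unfold rhoG
  congr 1
  · congr 1
    · congr 1
      · congr 1; split_ifs <;> ring
      · congr 1; split_ifs <;> ring
    · congr 1; split_ifs <;> ring
  · congr 1; ring

theorem tG_quad {A lx ly lb lc} (C : Cmp) (rx ry rB rc : ℕ) (hz : C.a1 ≤ 2)
    (hx : IsLin A lx) (hy : IsLin A ly) (hb : IsLin A lb) (hc : IsLin A lc) :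
    IsQuad (70000 * (A * A)) (fun x y z w =>
      tG C rx ry rB rc (lx x y z w) (ly x y z w) (lb x y z w) (lc x y z w)) := by
  have hA := hx.nonneg
  have hAA := mul_self_nonneg A
  have up {l} (h : IsLin A l) : IsLin (A + A) l := h.mono (by linarith)
  have p1 := (phiK_quad C.a1 C.a2 C.a3 (stt rx ((2 * rB) % 3) rc ry) (up hx) (up hy)
    (hb.sub hx) (up hc)).ite (C.g1 = 2) (by positivity)
  have p2 := (phiK_quad (2 - C.u4) C.a2 (2 - C.u2)
    (stt rx ((2 * (rx + rB)) % 3) rc ((ry + 2 * rc) % 3)) (up hx) (hy.sub hc)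
    (up hb) (up hc)).ite (C.g2 = 2) (by positivity)
  have p3 := ((rhoG_quad C.a1 rx ry rc hz hx hy hc).sub
    (((hy.mul hy).smul (24 * (C.a1 : ℤ)) (T := 48) (by
      rw [abs_of_nonneg (by positivity)]; norm_cast; omega)).ite (ry = 0)
      (by positivity))).ite (C.g1 = 1) (by positivity)
  have w1 : |w1C C| ≤ 6 := by unfold w1C; split_ifs <;> norm_num
  have w2 : |w2C C| ≤ 6 := by unfold w2C; split_ifs <;> norm_num
  have p4 := ((((hx.add hy).mul (hx.add hy)).smul _ w1).ite ((rx + ry) % 3 = 0)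
    (by positivity)).add (((((hc.add hb).sub hx).mul ((hc.add hb).sub hx)).smul _ w2).ite
    ((rc + rB + 2 * rx) % 3 = 0) (by positivity))
  exact (((p1.sub p2).add p3).sub (p4.smul 4 (T := 4) (by norm_num))).mono (by nlinarith)

theorem t8S_quad (s1 s2 s3 s4 s5 s6 s7 s8 s9 : ℕ) (rx ry rB rc : ℕ) (h1 : s1 ≤ 2) (h6 : s6 ≤ 2) :
    IsQuad 8960000 (t8S s1 s2 s3 s4 s5 s6 s7 s8 s9 rx ry rB rc) := by
  have hc : IsLin 1 (fun _ _ _ w => w) := IsLin.v4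
  have hy : IsLin 1 (fun _ y _ w => subY s5 y w) := by
    unfold subY
    split_ifs
    · exact IsLin.v4
    · exact IsLin.v2
  have hb : IsLin 2 (fun _ y z w => subB s4 s6 s9 (subY s5 y w) z w) := by
    unfold subB
    split_ifs
    · exact hy.add hc
    · exact hy.mono (by norm_num)
    · exact hc.mono (by norm_num)
    · exact IsLin.v3.mono (by norm_num)
  have hx : IsLin 4 (fun x y z w => subX s1 s2 s3 s7 s8 x (subY s5 y w)
      (subB s4 s6 s9 (subY s5 y w) z w) w) := by
    unfold subX
    split_ifs
    · exact hy.mono (by norm_num)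
    · exact hb.mono (by norm_num)
    · exact hc.mono (by norm_num)
    · exact (hy.add hb).mono (by norm_num)
    · exact (hy.add hc).mono (by norm_num)
    · exact IsLin.v1.mono (by norm_num)
  have hc := hc.mono (show (1 : ℤ) ≤ 4 by norm_num)
  have hy := hy.mono (show (1 : ℤ) ≤ 4 by norm_num)
  have hb := hb.mono (show (2 : ℤ) ≤ 4 by norm_num)
  have k2 (s : ℕ) : 2 - s ≤ 2 := by omega
  refine IsQuad.mono ?_ (show (70000 * (4 * 4) + 70000 * (4 * 4) + 70000 * (4 * 4)
    + 70000 * (4 * 4) + 70000 * (4 * 4) + 70000 * (4 * 4) + 70000 * (4 * 4)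
    + 70000 * (4 * 4) : ℤ) ≤ _ by norm_num)
  exact (((((((tG_quad _ rx ry rB rc h1 hx hy hb hc).add
    (tG_quad _ ry rx rB rc (k2 _) hy hx hb hc)).add
    (tG_quad _ rx ry rc rB h1 hx hy hc hb)).add
    (tG_quad _ ry rx rc rB (k2 _) hy hx hc hb)).add
    (tG_quad _ rB rc rx ry h6 hb hc hx hy)).add
    (tG_quad _ rc rB rx ry (k2 _) hc hb hx hy)).add
    (tG_quad _ rB rc ry rx h6 hb hc hy hx)).add
    (tG_quad _ rc rB ry rx (k2 _) hc hb hy hx)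

theorem zg_cases (t : ℤ) : (zg t = 2 ∧ 0 < t) ∨ (zg t = 1 ∧ t = 0) ∨ (zg t = 0 ∧ t < 0) := by
  unfold zg
  split_ifs <;> omega

theorem zg_le (t : ℤ) : zg t ≤ 2 := by
  rcases zg_cases t with h | h | h <;> omega

theorem zg_pos {t : ℤ} (h : 0 < t) : zg t = 2 := by simp [zg, h]

theorem zg_neg {t : ℤ} (h : t < 0) : zg t = 0 := by
  rcases zg_cases t with h | h | h <;> omega

theorem zg_flip {t u : ℤ} (h : u = -t) : zg u = 2 - zg t := by
  rcases zg_cases t with h | h | h <;> rcases zg_cases u with h | h | h <;> omega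

theorem zg_one {t : ℤ} : zg t = 1 ↔ t = 0 := by
  rcases zg_cases t with h | h | h <;> omega

theorem zg_congr {t u : ℤ} (h : u = t) : zg u = zg t := by rw [h]

theorem rs_lt (t : ℤ) : rs t < 3 := by unfold rs; omega

theorem rs_eq (t : ℤ) : (rs t : ℤ) = t % 3 := by unfold rs; omega

theorem cells_cover (x y B c : ℤ) (hy : 0 < y) (hc : 0 < c) (h1 : y ≤ x) (h2 : B ≤ x)
    (h3 : c ≤ B) :
    (zg (x - y) + 3 * zg (x - B) + 9 * zg (x - c) + 27 * zg (y - B) + 81 * zg (y - c)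
      + 243 * zg (B - c) + 729 * zg (x - y - B) + 2187 * zg (x - y - c) + 6561 * zg (B - y - c))
    ∈ cells := by
  rcases zg_cases (x - y) with ⟨e1, h⟩ | ⟨e1, h⟩ | ⟨e1, h⟩ <;> try (exfalso; omega)
  all_goals rcases zg_cases (x - B) with ⟨e2, h⟩ | ⟨e2, h⟩ | ⟨e2, h⟩ <;> try (exfalso; omega)
  all_goals rcases zg_cases (B - c) with ⟨e6, h⟩ | ⟨e6, h⟩ | ⟨e6, h⟩ <;> try (exfalso; omega)
  all_goals rcases zg_cases (x - c) with ⟨e3, h⟩ | ⟨e3, h⟩ | ⟨e3, h⟩ <;> try (exfalso; omega)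
  all_goals rcases zg_cases (y - B) with ⟨e4, h⟩ | ⟨e4, h⟩ | ⟨e4, h⟩ <;> try (exfalso; omega)
  all_goals rcases zg_cases (y - c) with ⟨e5, h⟩ | ⟨e5, h⟩ | ⟨e5, h⟩ <;> try (exfalso; omega)
  all_goals rcases zg_cases (x - y - B) with ⟨e7, h⟩ | ⟨e7, h⟩ | ⟨e7, h⟩ <;> try (exfalso; omega)
  all_goals rcases zg_cases (x - y - c) with ⟨e8, h⟩ | ⟨e8, h⟩ | ⟨e8, h⟩ <;> try (exfalso; omega)
  all_goals rcases zg_cases (B - y - c) with ⟨e9, h⟩ | ⟨e9, h⟩ | ⟨e9, h⟩ <;> try (exfalso; omega)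
  all_goals
    rw [e1, e2, e3, e4, e5, e6, e7, e8, e9]
    decide +kernel


theorem chk1_eq (s1 s2 s3 s4 s5 s6 s7 s8 s9 : ℕ) (r : ℕ × ℕ × ℕ × ℕ) (l1 : s1 ≤ 2) (l2 : s2 ≤ 2)
    (l3 : s3 ≤ 2) (l4 : s4 ≤ 2) (l5 : s5 ≤ 2) (l6 : s6 ≤ 2) (l7 : s7 ≤ 2) (l8 : s8 ≤ 2)
    (l9 : s9 ≤ 2) :
    chk1 (s1 + 3 * s2 + 9 * s3 + 27 * s4 + 81 * s5 + 243 * s6 + 729 * s7 + 2187 * s8 + 6561 * s9) r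
      = chk0 s1 s2 s3 s4 s5 s6 s7 s8 s9 r.1 r.2.1 r.2.2.1 r.2.2.2 := by
  have st (s t : ℕ) (h : s ≤ 2) : (s + 3 * t) % 3 = s ∧ (s + 3 * t) / 3 = t := by omega
  unfold chk1
  generalize hE : s1 + 3 * s2 + 9 * s3 + 27 * s4 + 81 * s5 + 243 * s6 + 729 * s7 + 2187 * s8
    + 6561 * s9 = E
  have hE' : E = s1 + 3 * (s2 + 3 * (s3 + 3 * (s4 + 3 * (s5 + 3 * (s6 + 3 * (s7 + 3 * (s8 + 3 *
    (s9 + 3 * 0)))))))) := by rw [← hE]; ring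
  have e2 : E / 9 = E / 3 / 3 := by rw [Nat.div_div_eq_div_mul]
  have e3 : E / 27 = E / 3 / 3 / 3 := by simp only [Nat.div_div_eq_div_mul, Nat.reduceMul]
  have e4 : E / 81 = E / 3 / 3 / 3 / 3 := by simp only [Nat.div_div_eq_div_mul, Nat.reduceMul]
  have e5 : E / 243 = E / 3 / 3 / 3 / 3 / 3 := by
    simp only [Nat.div_div_eq_div_mul, Nat.reduceMul]
  have e6 : E / 729 = E / 3 / 3 / 3 / 3 / 3 / 3 := by
    simp only [Nat.div_div_eq_div_mul, Nat.reduceMul]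
  have e7 : E / 2187 = E / 3 / 3 / 3 / 3 / 3 / 3 / 3 := by
    simp only [Nat.div_div_eq_div_mul, Nat.reduceMul]
  have e8 : E / 6561 = E / 3 / 3 / 3 / 3 / 3 / 3 / 3 / 3 := by
    simp only [Nat.div_div_eq_div_mul, Nat.reduceMul]
  rw [e2, e3, e4, e5, e6, e7, e8, hE']
  rw [(st _ _ l1).1, (st _ _ l1).2, (st _ _ l2).1, (st _ _ l2).2, (st _ _ l3).1, (st _ _ l3).2,
    (st _ _ l4).1, (st _ _ l4).2, (st _ _ l5).1, (st _ _ l5).2, (st _ _ l6).1, (st _ _ l6).2,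
    (st _ _ l7).1, (st _ _ l7).2, (st _ _ l8).1, (st _ _ l8).2, (st _ _ l9).1]

theorem chk0_sound (s1 s2 s3 s4 s5 s6 s7 s8 s9 rx ry rB rc : ℕ) (l1 : s1 ≤ 2) (l6 : s6 ≤ 2)
    (hcons : consR s1 s2 s3 s4 s5 s6 s7 s8 s9 rx ry rB rc = true)
    (hch : chk0 s1 s2 s3 s4 s5 s6 s7 s8 s9 rx ry rB rc = true) (x y B c : ℤ) :
    t8S s1 s2 s3 s4 s5 s6 s7 s8 s9 rx ry rB rc x y B c = 0 := by
  have hK : (8960000 : ℤ) < KK := by norm_num [KK]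
  have hq := t8S_quad s1 s2 s3 s4 s5 s6 s7 s8 s9 rx ry rB rc l1 l6
  unfold chk0 at hch
  rw [hcons, Bool.not_true, Bool.false_or] at hch
  have hch := eq_of_beq hch
  generalize t8S s1 s2 s3 s4 s5 s6 s7 s8 s9 rx ry rB rc = F at *
  exact hq.eq_zero hK hch x y B c

theorem t8Z_wlog (x y B c : ℤ) (hx : 0 < x) (hy : 0 < y) (hB : 0 < B) (hc : 0 < c) (h1 : y ≤ x)
    (h2 : B ≤ x) (h3 : c ≤ B) (hd : (x * y + B * c) % 3 = 0) : t8Z x y B c = 0 := by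
  have e1 : t8Z x y B c = t8G (zg (x - y)) (zg (x - B)) (zg (x - c)) (zg (y - B)) (zg (y - c))
      (zg (B - c)) (zg (x - y - B)) (zg (x - y - c)) (zg (B - y - c)) (rs x) (rs y) (rs B) (rs c)
      x y B c := by
    have n {t : ℤ} (h : t < 0) : zg t = 0 := zg_neg h
    have a1 : zg (y - x) = 2 - zg (x - y) := zg_flip (by ring)
    have a2 : zg (B - x) = 2 - zg (x - B) := zg_flip (by ring)
    have a3 : zg (c - x) = 2 - zg (x - c) := zg_flip (by ring)
    have a4 : zg (B - y) = 2 - zg (y - B) := zg_flip (by ring)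
    have a5 : zg (c - y) = 2 - zg (y - c) := zg_flip (by ring)
    have a6 : zg (c - B) = 2 - zg (B - c) := zg_flip (by ring)
    have b1 : zg (x - B - y) = zg (x - y - B) := zg_congr (by ring)
    have b2 : zg (x - c - y) = zg (x - y - c) := zg_congr (by ring)
    have b3 : zg (B - c - y) = zg (B - y - c) := zg_congr (by ring)
    have c1 : zg (y - x - B) = 0 := n (by linarith)
    have c2 : zg (y - x - c) = 0 := n (by linarith)
    have c3 : zg (c - B - x) = 0 := n (by linarith)
    have c4 : zg (c - B - y) = 0 := n (by linarith)
    have c5 : zg (B - c - x) = 0 := n (by linarith)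
    have c6 : zg (B - x - c) = 0 := n (by linarith)
    have c7 : zg (c - x - B) = 0 := n (by linarith)
    have c8 : zg (c - y - B) = 0 := n (by linarith)
    have c9 : zg (y - c - x) = 0 := n (by linarith)
    have c0 : zg (y - B - x) = 0 := n (by linarith)
    simp only [t8Z, tZ, t8G, cmpOf, a1, a2, a3, a4, a5, a6, b1, b2, b3, c0, c1, c2, c3, c4, c5, c6,
      c7, c8, c9]
  have q1 : subY (zg (y - c)) y c = y := by
    unfold subY; split_ifs with h
    · rw [zg_one] at h; linarith
    · rfl
  have q2 : subB (zg (y - B)) (zg (B - c)) (zg (B - y - c)) y B c = B := by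
    unfold subB; simp only [zg_one]; split_ifs <;> linarith
  have q3 : subX (zg (x - y)) (zg (x - B)) (zg (x - c)) (zg (x - y - B)) (zg (x - y - c)) x y B c
      = x := by
    unfold subX; simp only [zg_one]; split_ifs <;> linarith
  have hmem := cells_cover x y B c hy hc h1 h2 h3
  have l1 := zg_le (x - y)
  have l2 := zg_le (x - B)
  have l3 := zg_le (x - c)
  have l4 := zg_le (y - B)
  have l5 := zg_le (y - c)
  have l6 := zg_le (B - c)
  have l7 := zg_le (x - y - B)
  have l8 := zg_le (x - y - c)
  have l9 := zg_le (B - y - c)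
  have hr : (rs x, rs y, rs B, rs c) ∈ resList := by
    have i1 := rs_lt x
    have i2 := rs_lt y
    have i3 := rs_lt B
    have i4 := rs_lt c
    have : (rs x * rs y + rs B * rs c) % 3 = 0 := by
      zify
      simp only [rs_eq]
      rw [← hd, Int.add_emod, ← Int.mul_emod, ← Int.mul_emod, ← Int.add_emod]
    unfold resList
    simp only [List.mem_filter, List.mem_map, List.mem_range]
    refine ⟨⟨rs x + 3 * rs y + 9 * rs B + 27 * rs c, by omega, ?_⟩, by simpa using this⟩
    ext <;> dsimp only <;> omega
  have hch := chkAll_true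
  unfold chkAll at hch
  rw [List.all_eq_true] at hch
  have hch := hch _ hr
  rw [List.all_eq_true] at hch
  have hch := hch _ hmem
  have hcons : consR (zg (x - y)) (zg (x - B)) (zg (x - c)) (zg (y - B)) (zg (y - c))
      (zg (B - c)) (zg (x - y - B)) (zg (x - y - c)) (zg (B - y - c)) (rs x) (rs y) (rs B) (rs c)
      = true := by
    unfold consR subX subY subB
    simp only [zg_one, Bool.and_eq_true, beq_iff_eq]
    refine ⟨⟨?_, ?_⟩, ?_⟩ <;> split_ifs <;> simp only [rs] <;> omega
  generalize zg (x - y) = s1 at *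
  generalize zg (x - B) = s2 at *
  generalize zg (x - c) = s3 at *
  generalize zg (y - B) = s4 at *
  generalize zg (y - c) = s5 at *
  generalize zg (B - c) = s6 at *
  generalize zg (x - y - B) = s7 at *
  generalize zg (x - y - c) = s8 at *
  generalize zg (B - y - c) = s9 at *
  rw [chk1_eq _ _ _ _ _ _ _ _ _ _ l1 l2 l3 l4 l5 l6 l7 l8 l9] at hch
  have := chk0_sound _ _ _ _ _ _ _ _ _ _ _ _ _ l1 l6 hcons hch x y B c
  unfold t8S at this
  rw [q1, q2, q3] at this
  rw [e1, this]

theorem t8Z_eq_zero (x y B c : ℤ) (hx : 0 < x) (hy : 0 < y) (hB : 0 < B) (hc : 0 < c)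
    (hd : (x * y + B * c) % 3 = 0) : t8Z x y B c = 0 := by
  have s1 (x y B c : ℤ) : t8Z y x B c = t8Z x y B c := by unfold t8Z; ring
  have s2 (x y B c : ℤ) : t8Z x y c B = t8Z x y B c := by unfold t8Z; ring
  have s3 (x y B c : ℤ) : t8Z B c x y = t8Z x y B c := by unfold t8Z; ring
  have d1 (x y B c : ℤ) (h : (x * y + B * c) % 3 = 0) : (y * x + B * c) % 3 = 0 := by
    rw [← h]; ring_nf
  have d2 (x y B c : ℤ) (h : (x * y + B * c) % 3 = 0) : (x * y + c * B) % 3 = 0 := by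
    rw [← h]; ring_nf
  have d3 (x y B c : ℤ) (h : (x * y + B * c) % 3 = 0) : (B * c + x * y) % 3 = 0 := by
    rw [← h]; ring_nf
  have A : ∀ x y B c : ℤ, 0 < x → 0 < y → 0 < B → 0 < c → (x * y + B * c) % 3 = 0 → y ≤ x → c ≤ B →
      t8Z x y B c = 0 := by
    intro x y B c hx hy hB hc hd h1 h2
    rcases le_total B x with h | h
    · exact t8Z_wlog x y B c hx hy hB hc h1 h h2 hd
    · rw [← s3]
      exact t8Z_wlog B c x y hB hc hx hy h2 h h1 (d3 _ _ _ _ hd)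
  rcases le_total y x with h | h <;> rcases le_total c B with h' | h'
  · exact A x y B c hx hy hB hc hd h h'
  · rw [← s2]; exact A x y c B hx hy hc hB (d2 _ _ _ _ hd) h h'
  · rw [← s1]; exact A y x B c hy hx hB hc (d1 _ _ _ _ hd) h h'
  · rw [← s1, ← s2]; exact A y x c B hy hx hc hB (d2 _ _ _ _ (d1 _ _ _ _ hd)) h h'


/-! ### Summation over the quadruples -/

abbrev Z4 := ℤ × ℤ × ℤ × ℤ

noncomputable def PP (n : ℕ) : Finset Z4 :=
  (Finset.Icc (1 : ℤ) n ×ˢ Finset.Icc (1 : ℤ) n ×ˢ Finset.Icc (1 : ℤ) n ×ˢ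
    Finset.Icc (1 : ℤ) n).filter fun m => m.1 * m.2.1 + m.2.2.1 * m.2.2.2 = n

theorem mem_PP {n : ℕ} {x y B c : ℤ} :
    (x, y, B, c) ∈ PP n ↔ 0 < x ∧ 0 < y ∧ 0 < B ∧ 0 < c ∧ x * y + B * c = n := by
  simp only [PP, Finset.mem_filter, Finset.mem_product, Finset.mem_Icc]
  constructor
  · rintro ⟨⟨⟨h1, -⟩, ⟨h2, -⟩, ⟨h3, -⟩, ⟨h4, -⟩⟩, h⟩
    exact ⟨by omega, by omega, by omega, by omega, h⟩
  · rintro ⟨h1, h2, h3, h4, h⟩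
    have := mul_pos h1 h2
    have := mul_pos h3 h4
    refine ⟨⟨⟨by omega, ?_⟩, ⟨by omega, ?_⟩, ⟨by omega, ?_⟩, ⟨by omega, ?_⟩⟩, h⟩ <;> nlinarith

theorem sum_PP_swap1 (n : ℕ) (g : ℤ → ℤ → ℤ → ℤ → ℤ) :
    ∑ m ∈ PP n, g m.2.1 m.1 m.2.2.1 m.2.2.2 = ∑ m ∈ PP n, g m.1 m.2.1 m.2.2.1 m.2.2.2 := by
  refine Finset.sum_nbij' (fun m => (m.2.1, m.1, m.2.2.1, m.2.2.2))
    (fun m => (m.2.1, m.1, m.2.2.1, m.2.2.2)) ?_ ?_ ?_ ?_ ?_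
  · rintro ⟨x, y, B, c⟩ h
    rw [mem_PP] at h ⊢
    exact ⟨h.2.1, h.1, h.2.2.1, h.2.2.2.1, by rw [← h.2.2.2.2]; ring⟩
  · rintro ⟨x, y, B, c⟩ h
    rw [mem_PP] at h ⊢
    exact ⟨h.2.1, h.1, h.2.2.1, h.2.2.2.1, by rw [← h.2.2.2.2]; ring⟩
  · simp
  · simp
  · simp

theorem sum_PP_swap2 (n : ℕ) (g : ℤ → ℤ → ℤ → ℤ → ℤ) :
    ∑ m ∈ PP n, g m.2.2.1 m.2.2.2 m.1 m.2.1 = ∑ m ∈ PP n, g m.1 m.2.1 m.2.2.1 m.2.2.2 := by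
  refine Finset.sum_nbij' (fun m => (m.2.2.1, m.2.2.2, m.1, m.2.1))
    (fun m => (m.2.2.1, m.2.2.2, m.1, m.2.1)) ?_ ?_ ?_ ?_ ?_
  · rintro ⟨x, y, B, c⟩ h
    rw [mem_PP] at h ⊢
    exact ⟨h.2.2.1, h.2.2.2.1, h.1, h.2.1, by rw [← h.2.2.2.2]; ring⟩
  · rintro ⟨x, y, B, c⟩ h
    rw [mem_PP] at h ⊢
    exact ⟨h.2.2.1, h.2.2.2.1, h.1, h.2.1, by rw [← h.2.2.2.2]; ring⟩
  · simp
  · simp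
  · simp

theorem sum_tZ (n : ℕ) (h3 : 3 ∣ n) : ∑ m ∈ PP n, tZ m.1 m.2.1 m.2.2.1 m.2.2.2 = 0 := by
  have h8 : ∑ m ∈ PP n, t8Z m.1 m.2.1 m.2.2.1 m.2.2.2 = 0 := by
    apply Finset.sum_eq_zero
    rintro ⟨x, y, B, c⟩ h
    rw [mem_PP] at h
    apply t8Z_eq_zero _ _ _ _ h.1 h.2.1 h.2.2.1 h.2.2.2.1
    rw [h.2.2.2.2]
    omega
  have s1 := sum_PP_swap1 n tZ
  have s2 := sum_PP_swap2 n tZ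
  have s3 := sum_PP_swap1 n fun x y B c => tZ B c x y
  have s4 := sum_PP_swap2 n fun x y B c => tZ y x B c
  have s5 := sum_PP_swap2 n fun x y B c => tZ x y c B
  have s6 := sum_PP_swap2 n fun x y B c => tZ y x c B
  have s7 := sum_PP_swap1 n fun x y B c => tZ c B x y
  have s8 := sum_PP_swap1 n fun x y B c => tZ x y c B
  simp only [t8Z, Finset.sum_add_distrib] at h8
  linarith

theorem pre_eq (x y B c : ℤ) : preG (cmpOf x y B c) (rs x) (rs y) (rs B) (rs c) x y B c
    = if x < B then phi x y (B - x) c else 0 := by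
  unfold preG cmpOf phi
  dsimp only
  have e1 : (zg (B - x) = 2) ↔ x < B := by rcases zg_cases (B - x) with h | h | h <;> omega
  have e2 : x + (B - x) - y - c = B - y - c := by ring
  have e3 : (2 * rs B) % 3 = rs (-(x + (B - x))) := by unfold rs; omega
  simp only [e1, e2, e3]

theorem post_eq (x y B c : ℤ) : postG (cmpOf x y B c) (rs x) (rs y) (rs B) (rs c) x y B c
    = if c < y then phi x (y - c) B c else 0 := by
  unfold postG cmpOf phi
  dsimp only
  have e1 : (zg (y - c) = 2) ↔ c < y := by rcases zg_cases (y - c) with h | h | h <;> omega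
  have e2 : zg (x - (y - c)) = 2 - zg (y - x - c) := zg_flip (by ring)
  have e3 : zg (x + B - (y - c) - c) = 2 - zg (y - x - B) := zg_flip (by ring)
  have e4 : (2 * (rs x + rs B)) % 3 = rs (-(x + B)) := by unfold rs; omega
  have e5 : (rs y + 2 * rs c) % 3 = rs (y - c) := by unfold rs; omega
  simp only [e1, e2, e3, e4, e5]

def wallZ (x y c : ℤ) : ℤ := rho x y c - 24 * (zg (x - y) : ℤ) * f3 y

theorem wall_eq (x y B c : ℤ) : wallG (cmpOf x y B c) (rs x) (rs y) (rs c) x y c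
    = if x = B then wallZ x y c else 0 := by
  unfold wallG cmpOf wallZ rho f3
  dsimp only
  have e1 : (zg (B - x) = 1) ↔ x = B := by rw [zg_one]; omega
  simp only [e1]
  split_ifs <;> ring

def gwZ (x y B c : ℤ) : ℤ :=
  w1C (cmpOf x y B c) * f3 (x + y) + w2C (cmpOf x y B c) * f3 (c + B - x)

theorem gw_eq (x y B c : ℤ) : gwG (cmpOf x y B c) (rs x) (rs y) (rs B) (rs c) x y B c
    = gwZ x y B c := by
  unfold gwG gwZ f3
  have e1 : (rs x + rs y) % 3 = rs (x + y) := by unfold rs; omega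
  have e2 : (rs c + rs B + 2 * rs x) % 3 = rs (c + B - x) := by unfold rs; omega
  simp only [e1, e2]
  split_ifs <;> ring

theorem sum_phi (n : ℕ) :
    ∑ m ∈ PP n, (if m.1 < m.2.2.1 then phi m.1 m.2.1 (m.2.2.1 - m.1) m.2.2.2 else 0)
    = ∑ m ∈ PP n, (if m.2.2.2 < m.2.1 then phi m.1 (m.2.1 - m.2.2.2) m.2.2.1 m.2.2.2 else 0) := by
  rw [← Finset.sum_filter, ← Finset.sum_filter]
  refine Finset.sum_nbij' (fun m => (m.1, m.2.1 + m.2.2.2, m.2.2.1 - m.1, m.2.2.2))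
    (fun m => (m.1, m.2.1 - m.2.2.2, m.2.2.1 + m.1, m.2.2.2)) ?_ ?_ ?_ ?_ ?_
  · rintro ⟨x, y, B, c⟩ h
    simp only [Finset.mem_filter, mem_PP] at h ⊢
    obtain ⟨⟨h1, h2, h3, h4, h5⟩, h6⟩ := h
    exact ⟨⟨h1, by omega, by omega, h4, by rw [← h5]; ring⟩, by omega⟩
  · rintro ⟨x, y, B, c⟩ h
    simp only [Finset.mem_filter, mem_PP] at h ⊢
    obtain ⟨⟨h1, h2, h3, h4, h5⟩, h6⟩ := h
    exact ⟨⟨h1, by omega, by omega, h4, by rw [← h5]; ring⟩, by omega⟩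
  · simp
  · simp
  · rintro ⟨x, y, B, c⟩ -
    dsimp only
    rw [add_sub_cancel_right]

theorem sum_wall (n : ℕ) (g : ℤ → ℤ → ℤ → ℤ) :
    ∑ m ∈ PP n, (if m.1 = m.2.2.1 then g m.1 m.2.1 m.2.2.2 else 0)
    = ∑ p ∈ n.divisorsAntidiagonal, ∑ y ∈ Finset.Ico 1 p.2, g p.1 y (p.2 - y) := by
  rw [← Finset.sum_filter, Finset.sum_sigma']
  refine Finset.sum_nbij' (fun m => ⟨(m.1.toNat, (m.2.1 + m.2.2.2).toNat), m.2.1.toNat⟩)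
    (fun q => (q.1.1, q.2, q.1.1, q.1.2 - q.2)) ?_ ?_ ?_ ?_ ?_
  · rintro ⟨x, y, B, c⟩ h
    simp only [Finset.mem_filter, mem_PP] at h
    obtain ⟨⟨h1, h2, h3, h4, h5⟩, h6⟩ := h
    simp only [Finset.mem_sigma, Nat.mem_divisorsAntidiagonal, Finset.mem_Ico]
    refine ⟨⟨?_, ?_⟩, by omega, by omega⟩
    · zify
      rw [Int.toNat_of_nonneg h1.le, Int.toNat_of_nonneg (by omega), ← h5, ← h6]
      ring
    · have := mul_pos h1 h2
      have := mul_pos h3 h4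
      omega
  · rintro ⟨⟨x, e⟩, y⟩ h
    simp only [Finset.mem_sigma, Nat.mem_divisorsAntidiagonal, Finset.mem_Ico] at h
    obtain ⟨⟨h1, h2⟩, h3, h4⟩ := h
    simp only [Finset.mem_filter, mem_PP]
    have hx : 0 < x := by
      rcases Nat.eq_zero_or_pos x with h | h
      · subst h; simp at h1; exact absurd h1.symm h2
      · exact h
    refine ⟨⟨by omega, by omega, by omega, by omega, ?_⟩, trivial⟩
    rw [← h1]; push_cast; ring
  · rintro ⟨x, y, B, c⟩ h
    simp only [Finset.mem_filter, mem_PP] at h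
    obtain ⟨⟨h1, h2, h3, h4, h5⟩, h6⟩ := h
    ext <;> dsimp only <;> omega
  · rintro ⟨⟨x, e⟩, y⟩ h
    simp only [Finset.mem_sigma, Nat.mem_divisorsAntidiagonal, Finset.mem_Ico] at h
    simp
  · rintro ⟨x, y, B, c⟩ h
    simp only [Finset.mem_filter, mem_PP] at h
    obtain ⟨⟨h1, h2, h3, h4, h5⟩, h6⟩ := h
    dsimp only
    have e3 : (((y + c).toNat : ℕ) : ℤ) = y + c := Int.toNat_of_nonneg (by omega)
    rw [Int.toNat_of_nonneg h1.le, e3, Int.toNat_of_nonneg h2.le]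
    congr 1
    ring

theorem sum_gw (n : ℕ) (h3 : 3 ∣ n) : 4 * ∑ m ∈ PP n, gwZ m.1 m.2.1 m.2.2.1 m.2.2.2
    = ∑ p ∈ n.divisorsAntidiagonal, ∑ y ∈ Finset.Ico 1 p.2, wallZ p.1 y (p.2 - y) := by
  have h := sum_tZ n h3
  simp only [tZ, tG, pre_eq, post_eq, wall_eq, gw_eq, Finset.sum_sub_distrib,
    Finset.sum_add_distrib, ← Finset.mul_sum] at h
  rw [sum_phi, sum_wall] at h
  linarith


/-! ### Divisor sums -/

def W6 (b B c : ℤ) : ℤ :=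
  if |b| < B ∧ |b| < c then 6
  else if |b| ≤ B ∧ |b| ≤ c then (if B = c then 2 else 3) else 0

theorem sum_zg0 (x : ℤ) (hx : 0 < x) (E : ℕ) (hE : 1 ≤ E) :
    ∑ y ∈ Finset.Ico 1 E, (zg (x - (y : ℤ)) : ℤ) = if x < E then 2 * x - 1 else 2 * (E - 1) := by
  induction E, hE using Nat.le_induction with
  | base => simp; omega
  | succ E hE ih =>
    rw [Finset.sum_Ico_succ_top hE, ih]
    rcases zg_cases (x - E) with h | h | h <;> rw [h.1] <;> split_ifs <;> push_cast at * <;> omega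

theorem sum_zg1 (x : ℤ) (hx : 0 < x) (E : ℕ) (hE : 1 ≤ E) :
    ∑ y ∈ Finset.Ico 1 E, (zg (x - (y : ℤ)) : ℤ) * y = if x < E then x * x else E * (E - 1) := by
  induction E, hE using Nat.le_induction with
  | base => simp; omega
  | succ E hE ih =>
    rw [Finset.sum_Ico_succ_top hE, ih]
    rcases zg_cases (x - E) with h | h | h <;> rw [h.1] <;> push_cast
    · rw [if_neg (by omega), if_neg (by omega)]; ring
    · rw [if_neg (by omega), if_pos (by omega)]
      have : x = E := by omega
      rw [this]; ring
    · rw [if_pos (by omega), if_pos (by omega)]; ring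

theorem sum_tie (x : ℤ) (hx : 0 < x) (E : ℕ) (hE : 1 ≤ E) (g : ℤ → ℤ) :
    ∑ y ∈ Finset.Ico 1 E, (if zg (x - (y : ℤ)) = 1 then g y else 0)
      = if x < E then g x else 0 := by
  induction E, hE using Nat.le_induction with
  | base => simp; omega
  | succ E hE ih =>
    rw [Finset.sum_Ico_succ_top hE, ih]
    rcases zg_cases (x - E) with h | h | h <;> rw [h.1] <;> push_cast
    · rw [if_neg (by omega), if_neg (by omega)]; simp
    · rw [if_neg (by omega), if_pos (by omega)]
      have : x = E := by omega
      rw [this]; simp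
    · rw [if_pos (by omega), if_pos (by omega)]; simp

theorem sum_lin1 (E : ℕ) (hE : 1 ≤ E) :
    2 * ∑ y ∈ Finset.Ico 1 E, (y : ℤ) = E * (E - 1) := by
  induction E, hE using Nat.le_induction with
  | base => simp
  | succ E hE ih =>
    rw [Finset.sum_Ico_succ_top hE, mul_add, ih]
    push_cast; ring

theorem sum_three (k : ℕ) :
    2 * ∑ y ∈ Finset.Ico 1 (3 * (k + 1)), (if rs y = 0 then (y : ℤ) else 0) = 3 * (k + 1) * k := by
  induction k with
  | zero => decide
  | succ k ih =>
    have e : 3 * (k + 1 + 1) = 3 * (k + 1) + 1 + 1 + 1 := by ring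
    rw [e, Finset.sum_Ico_succ_top (by omega), Finset.sum_Ico_succ_top (by omega),
      Finset.sum_Ico_succ_top (by omega), mul_add, mul_add, mul_add, ih,
      if_pos (by unfold rs; omega), if_neg (by unfold rs; omega), if_neg (by unfold rs; omega)]
    push_cast; ring

def RC (x e : ℤ) : ℤ :=
  if x < e then
    (if x % 3 = 0 then -6 * x ^ 3 + 4 * (x * e) else 0)
    + (if e % 3 = 0 then 4 * (x * e) * e + 6 * (x * e) * x - 6 * (x * e) else 0)
    + (if x % 3 = 0 ∧ e % 3 = 0 then -6 * x ^ 2 - 6 * x ^ 3 - 6 * (x * e) * x + 2 * (x * e) else 0)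
  else
    (if x % 3 = 0 then -6 * (x * e) * e + 6 * (x * e) else 0)
    + (if e % 3 = 0 then 4 * (x * e) * e - 4 * (x * e) + 6 * e ^ 3 - 6 * e ^ 2 else 0)
    + (if x % 3 = 0 ∧ e % 3 = 0 then
        -6 * (x * e) * e - 2 * (x * e) - 6 * e ^ 3 + 6 * e ^ 2 else 0)

theorem sum_rho (x E : ℕ) (hx : 0 < x) (hE : 1 ≤ E) :
    ∑ y ∈ Finset.Ico 1 E, rho x y (E - y) = 4 * RC x E := by
  have hx' : (0 : ℤ) < x := by exact_mod_cast hx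
  have z0 := sum_zg0 x hx' E hE
  have z1 := sum_zg1 x hx' E hE
  have l1 := sum_lin1 E hE
  have l0 : ∑ y ∈ Finset.Ico 1 E, (1 : ℤ) = E - 1 := by simp; omega
  have t1 := sum_tie x hx' E hE
  have key : ∀ p1 p2 p3 q1 q2 q3 r1 r2 : ℤ, ∑ y ∈ Finset.Ico 1 E,
      (p1 + p2 * (y : ℤ) + (zg ((x : ℤ) - y) : ℤ) * (q1 + q2 * y)
        + if zg ((x : ℤ) - y) = 1 then r1 + r2 * (y : ℤ) else 0)
      = p1 * (E - 1) + p2 * (∑ y ∈ Finset.Ico 1 E, (y : ℤ))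
        + q1 * (if (x : ℤ) < E then 2 * (x : ℤ) - 1 else 2 * (E - 1))
        + q2 * (if (x : ℤ) < E then (x : ℤ) * x else E * (E - 1))
        + if (x : ℤ) < E then r1 + r2 * x else 0 := by
    intro p1 p2 p3 q1 q2 q3 r1 r2
    rw [← z0, ← z1, ← l0, ← t1 (fun y => r1 + r2 * y), Finset.mul_sum, Finset.mul_sum,
      Finset.mul_sum, Finset.mul_sum, ← Finset.sum_add_distrib, ← Finset.sum_add_distrib,
      ← Finset.sum_add_distrib, ← Finset.sum_add_distrib]
    apply Finset.sum_congr rfl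
    intro y _
    ring
  have c1 (y : ℕ) : ((rs y + rs ((E : ℤ) - y)) % 3 = 0) ↔ (E : ℤ) % 3 = 0 := by unfold rs; omega
  have c2 : (rs x = 0) ↔ (x : ℤ) % 3 = 0 := by unfold rs; omega
  have c3 (h : (E : ℤ) % 3 = 0) (y : ℕ) : (rs y = 0 ∧ rs ((E : ℤ) - y) = 0) ↔ rs y = 0 := by
    unfold rs; omega
  unfold rho rhoG RC
  simp only [c1, c2]
  by_cases hxx : (x : ℤ) % 3 = 0 <;> by_cases hee : (E : ℤ) % 3 = 0
  · simp only [hxx, hee, c3 hee, true_and, if_true, and_self]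
    obtain ⟨k, rfl⟩ : ∃ k, E = 3 * (k + 1) := ⟨E / 3 - 1, by omega⟩
    have s3 := sum_three k
    have e1 : ∀ y : ℕ, (if rs y = 0 then 4 * (24 * (x : ℤ) * y) else 0)
      = 96 * x * (if rs y = 0 then (y : ℤ) else 0) := by intro y; split_ifs <;> ring
    simp only [e1]
    rw [Finset.sum_add_distrib, ← Finset.mul_sum]
    set X : ℤ := (x : ℤ)
    set EE : ℤ := ((3 * (k + 1) : ℕ) : ℤ) with hEE
    have hk : (k : ℤ) = EE / 3 - 1 := by omega
    have hk2 : EE = 3 * (k + 1) := by rw [hEE]; push_cast; ring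
    have e2 := key (4 * (6 * X * X) + 4 * (12 * X * X)) 0 0
      (2 * (-6 * X * (X + EE)) + 2 * (-12 * (X * (X + EE))))
      (24 * EE + 2 * (12 * X) - 24 * EE) 0
      (4 * (4 * X * X + X * EE) + 4 * (-2 * X * (X + EE)) + 4 * (4 * X * (X + EE)))
      (4 * (-X) + 4 * (2 * X) + 4 * (-4 * X))
    rw [Finset.sum_congr rfl (g := fun y : ℕ => (4 * (6 * X * X) + 4 * (12 * X * X)) + 0 * (y : ℤ)
      + (zg (X - y) : ℤ) * ((2 * (-6 * X * (X + EE)) + 2 * (-12 * (X * (X + EE)))) +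
        (24 * EE + 2 * (12 * X) - 24 * EE) * y) + if zg (X - (y : ℤ)) = 1 then
        (4 * (4 * X * X + X * EE) + 4 * (-2 * X * (X + EE)) + 4 * (4 * X * (X + EE))) +
        (4 * (-X) + 4 * (2 * X) + 4 * (-4 * X)) * (y : ℤ) else 0)
        (by intro y _; split_ifs <;> ring), e2]
    have s4 : 96 * X * ∑ y ∈ Finset.Ico 1 (3 * (k + 1)), (if rs y = 0 then (y : ℤ) else 0)
      = 48 * X * (3 * (k + 1) * k) := by rw [← s3]; ring
    rw [s4]
    split_ifs <;> rw [hk2] <;> ring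
  · simp only [hxx, hee, true_and, if_true, and_false, if_false, add_zero]
    set X : ℤ := (x : ℤ)
    set EE : ℤ := (E : ℤ)
    rw [Finset.sum_congr rfl (g := fun y : ℕ => (4 * (6 * X * X)) + 0 * (y : ℤ)
      + (zg (X - y) : ℤ) * ((2 * (-6 * X * (X + EE))) +
        0 * y) + if zg (X - (y : ℤ)) = 1 then
        (4 * (4 * X * X + X * EE)) + (4 * (-X)) * (y : ℤ) else 0)
        (by intro y hy
            have : ¬ (rs y = 0 ∧ rs (EE - y) = 0) := by
              rintro ⟨h1, h2⟩
              apply hee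
              rw [← c1 y, h1, h2]
            simp only [if_neg this]
            split_ifs <;> ring), key _ _ 0 _ _ 0 _ _]
    split_ifs <;> ring
  · simp only [hxx, hee, false_and, if_true, if_false, add_zero, zero_add]
    set X : ℤ := (x : ℤ)
    set EE : ℤ := (E : ℤ)
    rw [Finset.sum_congr rfl (g := fun y : ℕ => 0 + (32 * X) * (y : ℤ)
      + (zg (X - y) : ℤ) * (0 + (24 * EE) * y) + if zg (X - (y : ℤ)) = 1 then
        (4 * (-2 * X * (X + EE))) + (8 * X) * (y : ℤ) else 0)
        (by intro y hy; split_ifs <;> ring), key _ _ 0 _ _ 0 _ _]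
    have l2 : 32 * X * ∑ y ∈ Finset.Ico 1 E, (y : ℤ) = 16 * X * (EE * (EE - 1)) := by
      rw [← l1]; ring
    rw [l2]
    split_ifs <;> ring
  · simp only [hxx, hee, false_and, if_false, add_zero]
    simp

theorem sum_f3 (n x e : ℕ) (he : 0 < e) (hen : e ≤ n) :
    ∑ y ∈ Finset.Ico 1 e, (-(24 * (zg ((x : ℤ) - y) : ℤ) * f3 y))
      + 8 * ∑ k ∈ Finset.Ico 1 (n + 1), W6 k x e * f3 k
    = if e < x then 24 * f3 e else if x = e then 16 * f3 e else 0 := by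
  have h1 : ∑ y ∈ Finset.Ico 1 e, (-(24 * (zg ((x : ℤ) - y) : ℤ) * f3 y))
    = ∑ y ∈ Finset.Ico 1 (n + 1), if y < e then (-(24 * (zg ((x : ℤ) - y) : ℤ) * f3 y)) else 0 := by
    rw [← Finset.sum_filter]
    apply Finset.sum_congr _ (fun _ _ => rfl)
    ext y
    simp only [Finset.mem_filter, Finset.mem_Ico]
    omega
  rw [h1, Finset.mul_sum, ← Finset.sum_add_distrib]
  rw [Finset.sum_congr rfl (g := fun k : ℕ => if k = e then
    (if e < x then 24 * f3 e else if x = e then 16 * f3 e else 0) else 0)]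
  · rw [Finset.sum_ite_eq', if_pos (by rw [Finset.mem_Ico]; omega)]
  · intro k _
    unfold W6
    rw [abs_of_nonneg (by omega : (0 : ℤ) ≤ k)]
    rcases zg_cases ((x : ℤ) - k) with h | h | h <;> rw [h.1] <;>
      rcases lt_trichotomy k e with h' | h' | h'
    · rw [if_pos h', if_pos (by omega), if_neg (by omega)]; push_cast; ring
    · subst h'
      rw [if_neg (by omega), if_neg (by omega), if_pos (by omega), if_neg (by omega), if_pos rfl,
        if_pos (by omega)]; ring
    · rw [if_neg (by omega), if_neg (by omega), if_neg (by omega), if_neg (by omega)]; ring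
    · rw [if_pos h', if_neg (by omega), if_pos (by omega), if_neg (by omega), if_neg (by omega)]
      push_cast; ring
    · subst h'
      rw [if_neg (by omega), if_neg (by omega), if_pos (by omega), if_pos (by omega), if_pos rfl,
        if_neg (by omega), if_pos (by omega)]; ring
    · rw [if_neg (by omega), if_neg (by omega), if_neg (by omega), if_neg (by omega)]; ring
    · rw [if_pos h', if_neg (by omega), if_neg (by omega), if_neg (by omega)]
      push_cast; ring
    · subst h'
      rw [if_neg (by omega), if_neg (by omega), if_neg (by omega), if_pos rfl,
        if_neg (by omega), if_neg (by omega)]; ring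
    · rw [if_neg (by omega), if_neg (by omega), if_neg (by omega), if_neg (by omega)]; ring

def X0 (n : ℕ) : ℤ :=
  4 * ∑ p ∈ n.divisorsAntidiagonal, ∑ k ∈ Finset.Ico 1 (n + 1), W6 k p.1 p.2 * f3 k

/-- the contribution of a divisor pair -/
def GC (x e : ℤ) : ℤ :=
  (if x % 3 = 0 then 16 * (x * e) * x else 0)
  - (if x < e ∧ x % 3 = 0 ∧ e % 3 = 0 then 48 * (x ^ 3 + (x * e) * x) else 0)
  - (if x = e then 48 * x ^ 3 else 0)

theorem f3_eq (s : ℤ) : f3 s = if s % 3 = 0 then s ^ 2 else 0 := by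
  unfold f3
  have : rs s = 0 ↔ s % 3 = 0 := by unfold rs; omega
  simp only [this]
  split_ifs <;> ring

theorem RC_symm (x e : ℤ) (h : x % 3 = 0 ∨ e % 3 = 0) (hxe : x < e) :
    (4 * RC x e) + (4 * RC e x + 24 * f3 x) = GC x e + GC e x := by
  unfold RC GC
  rw [f3_eq]
  have h1 : ¬ e < x := by omega
  have h2 : ¬ x = e := by omega
  have h3 : ¬ e = x := by omega
  simp only [h1, h2, h3, hxe, if_true, if_false, false_and, true_and]
  by_cases a : x % 3 = 0 <;> by_cases b : e % 3 = 0 <;>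
    simp only [a, b, if_true, if_false, and_self, and_true, and_false, false_and]
  · ring
  · ring
  · ring
  · simp_all

theorem RC_diag (x : ℤ) (h : x % 3 = 0) : 4 * RC x x = GC x x := by
  unfold RC GC
  simp only [h, lt_irrefl, if_true, if_false, false_and, and_self]
  ring

theorem sum_C (n : ℕ) (hn : 0 < n) (h3 : 3 ∣ n) :
    4 * ∑ m ∈ PP n, gwZ m.1 m.2.1 m.2.2.1 m.2.2.2 + 2 * X0 n
    = ∑ p ∈ n.divisorsAntidiagonal, (GC p.1 p.2 + if p.1 = p.2 then 16 * (n : ℤ) else 0) := by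
  have pos : ∀ p ∈ n.divisorsAntidiagonal, 0 < p.1 ∧ 0 < p.2 ∧ p.1 * p.2 = n ∧ p.2 ≤ n := by
    intro p hp
    rw [Nat.mem_divisorsAntidiagonal] at hp
    have a : 0 < p.1 := Nat.pos_of_ne_zero (by rintro h; rw [h] at hp; simp at hp; omega)
    have b : 0 < p.2 := Nat.pos_of_ne_zero (by rintro h; rw [h] at hp; simp at hp; omega)
    exact ⟨a, b, hp.1, by nlinarith [hp.1]⟩
  have e1 : 4 * ∑ m ∈ PP n, gwZ m.1 m.2.1 m.2.2.1 m.2.2.2 + 2 * X0 n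
    = ∑ p ∈ n.divisorsAntidiagonal, ((4 * RC p.1 p.2 + if p.2 < p.1 then 24 * f3 p.2 else 0)
      + if p.1 = p.2 then 16 * (n : ℤ) else 0) := by
    rw [sum_gw n h3, X0, ← mul_assoc, Finset.mul_sum, ← Finset.sum_add_distrib]
    apply Finset.sum_congr rfl
    intro p hp
    obtain ⟨h1, h2, h4, h5⟩ := pos p hp
    have q1 := sum_f3 n p.1 p.2 h2 h5
    have q2 := sum_rho p.1 p.2 h1 h2
    unfold wallZ
    rw [Finset.sum_sub_distrib]
    rw [Finset.sum_neg_distrib] at q1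
    have q3 : (if p.2 < p.1 then 24 * f3 p.2 else if p.1 = p.2 then 16 * f3 p.2 else 0)
      = (if p.2 < p.1 then 24 * f3 p.2 else 0) + if p.1 = p.2 then (16 * n : ℤ) else 0 := by
      by_cases hh : p.1 = p.2
      · have : (p.2 : ℤ) % 3 = 0 := by
          rw [← h4, hh] at h3
          have := (Nat.Prime.dvd_mul Nat.prime_three).1 h3
          omega
        rw [if_neg (by omega), if_pos hh, if_neg (by omega), if_pos hh, f3_eq, if_pos this, ← h4,
          hh]
        push_cast; ring
      · simp only [hh, if_false]; ring
    rw [q3] at q1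
    linarith
  rw [e1]
  have sw (g : ℕ × ℕ → ℤ) : ∑ p ∈ n.divisorsAntidiagonal, g p.swap
      = ∑ p ∈ n.divisorsAntidiagonal, g p := by
    refine Finset.sum_nbij' Prod.swap Prod.swap ?_ ?_ ?_ ?_ ?_
    · intro p hp; exact Nat.swap_mem_divisorsAntidiagonal.2 hp
    · intro p hp; exact Nat.swap_mem_divisorsAntidiagonal.2 hp
    · simp
    · simp
    · simp
  have s1 := sw fun p => 4 * RC p.1 p.2 + if p.2 < p.1 then 24 * f3 p.2 else 0
  have s2 := sw fun p => GC p.1 p.2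
  have s3 : ∑ p ∈ n.divisorsAntidiagonal, ((4 * RC p.1 p.2 + if p.2 < p.1 then 24 * f3 p.2 else 0)
      + (4 * RC p.swap.1 p.swap.2 + if p.swap.2 < p.swap.1 then 24 * f3 p.swap.2 else 0))
      = ∑ p ∈ n.divisorsAntidiagonal, (GC p.1 p.2 + GC p.swap.1 p.swap.2) := by
    apply Finset.sum_congr rfl
    rintro ⟨x, e⟩ hp
    obtain ⟨h1, h2, h4, h5⟩ := pos _ hp
    have h6 : (x : ℤ) % 3 = 0 ∨ (e : ℤ) % 3 = 0 := by
      rw [← h4] at h3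
      have := (Nat.Prime.dvd_mul Nat.prime_three).1 h3
      dsimp only at this
      omega
    dsimp only [Prod.swap]
    rcases lt_trichotomy x e with h | h | h
    · rw [if_neg (by omega), if_pos h]
      have := RC_symm x e h6 (by omega)
      linarith
    · subst h
      rw [if_neg (by omega)]
      have := RC_diag x (by omega)
      linarith
    · rw [if_neg (by omega : ¬ x < e), if_pos h]
      have := RC_symm e x h6.symm (by omega)
      linarith
  simp only [Finset.sum_add_distrib] at s1 s2 s3 ⊢
  linarith


theorem sumGC_a (n : ℕ) (hn : 0 < n) (h3 : 3 ∣ n) :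
    ∑ p ∈ n.divisorsAntidiagonal, (if (p.1 : ℤ) % 3 = 0 then 16 * ((p.1 : ℤ) * p.2) * p.1 else 0)
    = 48 * n * ∑ d ∈ (n / 3).divisors, (d : ℤ) := by
  obtain ⟨m, rfl⟩ := h3
  rw [Nat.mul_div_cancel_left _ (by norm_num), ← Finset.sum_filter, Finset.mul_sum]
  refine Finset.sum_nbij' (fun p => p.1 / 3) (fun d => (3 * d, m / d)) ?_ ?_ ?_ ?_ ?_
  · rintro ⟨x, e⟩ h
    simp only [Finset.mem_filter, Nat.mem_divisorsAntidiagonal] at h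
    obtain ⟨⟨h1, h2⟩, h3⟩ := h
    obtain ⟨k, rfl⟩ : ∃ k, x = 3 * k := ⟨x / 3, by omega⟩
    rw [Nat.mem_divisors, Nat.mul_div_cancel_left _ (by norm_num)]
    exact ⟨⟨e, by nlinarith⟩, by omega⟩
  · intro d h
    rw [Nat.mem_divisors] at h
    simp only [Finset.mem_filter, Nat.mem_divisorsAntidiagonal]
    refine ⟨⟨?_, by omega⟩, by push_cast; omega⟩
    rw [mul_assoc, Nat.mul_div_cancel' h.1]
  · rintro ⟨x, e⟩ h
    simp only [Finset.mem_filter, Nat.mem_divisorsAntidiagonal] at h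
    obtain ⟨⟨h1, h2⟩, h3⟩ := h
    obtain ⟨k, rfl⟩ : ∃ k, x = 3 * k := ⟨x / 3, by omega⟩
    dsimp only
    rw [Nat.mul_div_cancel_left _ (by norm_num)]
    have : m = k * e := by nlinarith
    have hk : 0 < k := Nat.pos_of_ne_zero (by rintro rfl; simp at this; omega)
    rw [this, Nat.mul_div_cancel_left _ hk]
  · intro d _
    simp
  · rintro ⟨x, e⟩ h
    simp only [Finset.mem_filter, Nat.mem_divisorsAntidiagonal] at h
    obtain ⟨⟨h1, h2⟩, h3⟩ := h
    obtain ⟨k, rfl⟩ : ∃ k, x = 3 * k := ⟨x / 3, by omega⟩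
    dsimp only
    rw [Nat.mul_div_cancel_left _ (by norm_num), ← h1]
    push_cast; ring

theorem sumGC_b (n : ℕ) (hn : 0 < n) (h9 : 9 ∣ n) :
    ∑ p ∈ n.divisorsAntidiagonal, (if (p.1 : ℤ) < p.2 ∧ (p.1 : ℤ) % 3 = 0 ∧ (p.2 : ℤ) % 3 = 0 then
      48 * ((p.1 : ℤ) ^ 3 + ((p.1 : ℤ) * p.2) * p.1) else 0)
    = ∑ d ∈ (n / 9).divisors.filter (fun d => d ^ 2 < n / 9),
      (48 * (27 * (d : ℤ) ^ 3 + 3 * n * d)) := by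
  obtain ⟨m, rfl⟩ := h9
  rw [Nat.mul_div_cancel_left _ (by norm_num), ← Finset.sum_filter]
  refine Finset.sum_nbij' (fun p => p.1 / 3) (fun d => (3 * d, 3 * (m / d))) ?_ ?_ ?_ ?_ ?_
  · rintro ⟨x, e⟩ h
    simp only [Finset.mem_filter, Nat.mem_divisorsAntidiagonal] at h
    obtain ⟨⟨h1, h2⟩, h3, h4, h5⟩ := h
    obtain ⟨k, rfl⟩ : ∃ k, x = 3 * k := ⟨x / 3, by omega⟩
    obtain ⟨l, rfl⟩ : ∃ l, e = 3 * l := ⟨e / 3, by omega⟩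
    rw [Finset.mem_filter, Nat.mem_divisors, Nat.mul_div_cancel_left _ (by norm_num)]
    have hm : m = k * l := by nlinarith
    have hk : 0 < k := Nat.pos_of_ne_zero (by rintro rfl; simp at hm; omega)
    refine ⟨⟨⟨l, hm⟩, by omega⟩, ?_⟩
    rw [hm, sq]
    exact Nat.mul_lt_mul_of_pos_left (by omega) hk
  · intro d h
    rw [Finset.mem_filter, Nat.mem_divisors] at h
    obtain ⟨⟨⟨l, rfl⟩, h1⟩, h2⟩ := h
    have hd : 0 < d := Nat.pos_of_ne_zero (by rintro rfl; simp at h1)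
    rw [sq] at h2
    have := Nat.lt_of_mul_lt_mul_left h2
    simp only [Finset.mem_filter, Nat.mem_divisorsAntidiagonal]
    rw [Nat.mul_div_cancel_left _ hd]
    exact ⟨⟨by ring, by omega⟩, by omega, by omega, by omega⟩
  · rintro ⟨x, e⟩ h
    simp only [Finset.mem_filter, Nat.mem_divisorsAntidiagonal] at h
    obtain ⟨⟨h1, h2⟩, h3, h4, h5⟩ := h
    obtain ⟨k, rfl⟩ : ∃ k, x = 3 * k := ⟨x / 3, by omega⟩
    obtain ⟨l, rfl⟩ : ∃ l, e = 3 * l := ⟨e / 3, by omega⟩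
    have hm : m = k * l := by nlinarith
    have hk : 0 < k := Nat.pos_of_ne_zero (by rintro rfl; simp at hm; omega)
    dsimp only
    rw [Nat.mul_div_cancel_left _ (by norm_num), hm, Nat.mul_div_cancel_left _ hk]
  · intro d _
    simp
  · rintro ⟨x, e⟩ h
    simp only [Finset.mem_filter, Nat.mem_divisorsAntidiagonal] at h
    obtain ⟨⟨h1, h2⟩, h3, h4, h5⟩ := h
    obtain ⟨k, rfl⟩ : ∃ k, x = 3 * k := ⟨x / 3, by omega⟩
    dsimp only
    rw [Nat.mul_div_cancel_left _ (by norm_num), ← h1]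
    push_cast; ring

theorem sumGC_b0 (n : ℕ) (h9 : ¬ 9 ∣ n) :
    ∑ p ∈ n.divisorsAntidiagonal, (if (p.1 : ℤ) < p.2 ∧ (p.1 : ℤ) % 3 = 0 ∧ (p.2 : ℤ) % 3 = 0 then
      48 * ((p.1 : ℤ) ^ 3 + ((p.1 : ℤ) * p.2) * p.1) else 0) = 0 := by
  apply Finset.sum_eq_zero
  rintro ⟨x, e⟩ h
  rw [Nat.mem_divisorsAntidiagonal] at h
  rw [if_neg]
  rintro ⟨h3, h4, h5⟩
  dsimp only at *
  obtain ⟨k, rfl⟩ : ∃ k, x = 3 * k := ⟨x / 3, by omega⟩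
  obtain ⟨l, rfl⟩ : ∃ l, e = 3 * l := ⟨e / 3, by omega⟩
  apply h9
  exact ⟨k * l, by rw [← h.1]; ring⟩

theorem sum_diag (n q : ℕ) (hn : 0 < n) (hq : n = q * q) (g : ℕ → ℤ) :
    ∑ p ∈ n.divisorsAntidiagonal, (if (p.1 : ℤ) = p.2 then g p.1 else 0) = g q := by
  rw [← Finset.sum_filter]
  rw [Finset.sum_eq_single_of_mem (q, q)]
  · simp only [Finset.mem_filter, Nat.mem_divisorsAntidiagonal]
    exact ⟨⟨hq.symm, by omega⟩, trivial⟩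
  · rintro ⟨x, e⟩ h h'
    simp only [Finset.mem_filter, Nat.mem_divisorsAntidiagonal] at h
    exfalso
    apply h'
    obtain ⟨⟨h1, h2⟩, h3⟩ := h
    obtain rfl : x = e := by exact_mod_cast h3
    rw [hq] at h1
    have : x = q := Nat.mul_self_inj.1 h1
    rw [this]

theorem sum_diag0 (n : ℕ) (hq : ¬ IsSquare n) (g : ℕ → ℤ) :
    ∑ p ∈ n.divisorsAntidiagonal, (if (p.1 : ℤ) = p.2 then g p.1 else 0) = 0 := by
  apply Finset.sum_eq_zero
  rintro ⟨x, e⟩ h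
  rw [Nat.mem_divisorsAntidiagonal] at h
  rw [if_neg]
  intro h3
  obtain rfl : x = e := by exact_mod_cast h3
  exact hq ⟨x, h.1.symm⟩

theorem sq_rpow (n q : ℕ) (hq : n = q * q) : (n : ℝ) ^ ((3 : ℝ) / 2) = (q : ℝ) ^ 3 := by
  have h0 : (0 : ℝ) ≤ q := Nat.cast_nonneg q
  rw [hq, Nat.cast_mul, ← sq, ← Real.rpow_natCast, ← Real.rpow_mul h0, ← Real.rpow_natCast]
  norm_num

theorem sum_GC (n : ℕ) (hn : 0 < n) (h3 : 3 ∣ n) :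
    ((∑ p ∈ n.divisorsAntidiagonal, GC p.1 p.2 : ℤ) : ℝ) = 24 * (
      -((if IsSquare n then (1 : ℝ) else 0) * (n : ℝ) ^ ((3 : ℝ) / 2))
      - 54 * (if 9 ∣ n then (1 : ℝ) else 0) *
          (∑ d ∈ (n / 9).divisors.filter (fun d => d ^ 2 < n / 9), (d : ℝ) ^ 3)
      + 2 * (n : ℝ) * (∑ d ∈ (n / 3).divisors, (d : ℝ))
      - 6 * (n : ℝ) * (if 9 ∣ n then (1 : ℝ) else 0) *
          (∑ d ∈ (n / 9).divisors.filter (fun d => d ^ 2 < n / 9), (d : ℝ))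
      - (n : ℝ) ^ ((3 : ℝ) / 2) * (if IsSquare n then (1 : ℝ) else 0)) := by
  unfold GC
  rw [Finset.sum_sub_distrib, Finset.sum_sub_distrib, sumGC_a n hn h3]
  have hc : ((∑ p ∈ n.divisorsAntidiagonal, (if (p.1 : ℤ) = p.2 then 48 * (p.1 : ℤ) ^ 3 else 0)
      : ℤ) : ℝ) = 48 * (if IsSquare n then (1 : ℝ) else 0) * (n : ℝ) ^ ((3 : ℝ) / 2) := by
    by_cases hs : IsSquare n
    · obtain ⟨q, hq⟩ := id hs
      rw [sum_diag n q hn hq (fun x => 48 * (x : ℤ) ^ 3), if_pos hs, sq_rpow n q hq]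
      push_cast; ring
    · rw [sum_diag0 n hs (fun x => 48 * (x : ℤ) ^ 3), if_neg hs]
      simp
  have hb : ((∑ p ∈ n.divisorsAntidiagonal, (if (p.1 : ℤ) < p.2 ∧ (p.1 : ℤ) % 3 = 0 ∧
      (p.2 : ℤ) % 3 = 0 then 48 * ((p.1 : ℤ) ^ 3 + ((p.1 : ℤ) * p.2) * p.1) else 0) : ℤ) : ℝ)
      = (if 9 ∣ n then (1 : ℝ) else 0) * (48 * 27 *
        (∑ d ∈ (n / 9).divisors.filter (fun d => d ^ 2 < n / 9), (d : ℝ) ^ 3) + 48 * 3 * n *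
          (∑ d ∈ (n / 9).divisors.filter (fun d => d ^ 2 < n / 9), (d : ℝ))) := by
    by_cases h9 : 9 ∣ n
    · rw [sumGC_b n hn h9, if_pos h9, one_mul, Finset.mul_sum, Finset.mul_sum,
        ← Finset.sum_add_distrib]
      push_cast
      apply Finset.sum_congr rfl
      intro d _
      ring
    · rw [sumGC_b0 n h9, if_neg h9]
      simp
  rw [Int.cast_sub, Int.cast_sub, hb, hc]
  push_cast
  ring


/-! ### Reduction theory -/

abbrev SL2 := Matrix.SpecialLinearGroup (Fin 2) ℤ

theorem act_eq (γ : SL2) (Q : ℤ × ℤ × ℤ) : formAct γ Q =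
    (Q.1 * γ.1 0 0 ^ 2 + Q.2.1 * γ.1 0 0 * γ.1 1 0 + Q.2.2 * γ.1 1 0 ^ 2,
     2 * Q.1 * γ.1 0 0 * γ.1 0 1 + Q.2.1 * (γ.1 0 0 * γ.1 1 1 + γ.1 0 1 * γ.1 1 0)
       + 2 * Q.2.2 * γ.1 1 0 * γ.1 1 1,
     Q.1 * γ.1 0 1 ^ 2 + Q.2.1 * γ.1 0 1 * γ.1 1 1 + Q.2.2 * γ.1 1 1 ^ 2) := by
  unfold formAct formEval
  ext <;> dsimp only <;> ring

theorem det_eq (γ : SL2) : γ.1 0 0 * γ.1 1 1 - γ.1 0 1 * γ.1 1 0 = 1 := by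
  have := γ.2
  rwa [Matrix.det_fin_two] at this

theorem act_mul (γ δ : SL2) (Q : ℤ × ℤ × ℤ) : formAct γ (formAct δ Q) = formAct (δ * γ) Q := by
  rw [act_eq, act_eq, act_eq]
  simp only [Matrix.SpecialLinearGroup.coe_mul, Matrix.mul_apply, Fin.sum_univ_two]
  ext <;> dsimp only <;> ring

theorem act_one (Q : ℤ × ℤ × ℤ) : formAct 1 Q = Q := by
  rw [act_eq]
  simp

theorem disc_act (γ : SL2) (Q : ℤ × ℤ × ℤ) : formDisc (formAct γ Q) = formDisc Q := by
  have h := det_eq γ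
  rw [act_eq]
  unfold formDisc
  dsimp only
  have : formDisc Q = formDisc Q * (γ.1 0 0 * γ.1 1 1 - γ.1 0 1 * γ.1 1 0) ^ 2 := by rw [h]; ring
  unfold formDisc at this
  rw [this]
  ring

theorem eval_pos (a b c p r : ℤ) (ha : 0 < a) (hd : b ^ 2 - 4 * a * c < 0)
    (h : ¬ (p = 0 ∧ r = 0)) : 0 < a * p ^ 2 + b * p * r + c * r ^ 2 := by
  have e : 4 * a * (a * p ^ 2 + b * p * r + c * r ^ 2)
      = (2 * a * p + b * r) ^ 2 + (4 * a * c - b ^ 2) * r ^ 2 := by ring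
  by_contra hh
  push Not at hh
  have h1 : 4 * a * (a * p ^ 2 + b * p * r + c * r ^ 2) ≤ 0 := by nlinarith
  rw [e] at h1
  have h2 : 0 ≤ (2 * a * p + b * r) ^ 2 := sq_nonneg _
  have h3 : 0 ≤ r ^ 2 := sq_nonneg _
  have h4 : r = 0 := by
    by_contra h5
    have : 0 < r ^ 2 := by positivity
    nlinarith
  subst h4
  apply h
  have : (2 * a * p) ^ 2 ≤ 0 := by nlinarith
  have : 2 * a * p = 0 := by
    have := le_antisymm this (sq_nonneg _)
    exact pow_eq_zero_iff (two_ne_zero) |>.1 this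
  refine ⟨?_, rfl⟩
  rcases mul_eq_zero.1 this with h | h
  · omega
  · exact h

theorem posDef_act (γ : SL2) (Q : ℤ × ℤ × ℤ) (h : IsPosDef Q) : IsPosDef (formAct γ Q) := by
  refine ⟨?_, by rw [disc_act]; exact h.2⟩
  rw [act_eq]
  dsimp only
  apply eval_pos _ _ _ _ _ h.1 h.2
  rintro ⟨h1, h2⟩
  have := det_eq γ
  rw [h1, h2] at this
  simp at this

/-- `(a,b,c)` with `|b| ≤ a ≤ c`. -/
def IsRed (Q : ℤ × ℤ × ℤ) : Prop := -Q.1 ≤ Q.2.1 ∧ Q.2.1 ≤ Q.1 ∧ Q.1 ≤ Q.2.2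

theorem min_red (a b c p r : ℤ) (h1 : -a ≤ b) (h2 : b ≤ a) (h3 : a ≤ c) :
    a * (p ^ 2 - |p * r| + r ^ 2) ≤ a * p ^ 2 + b * p * r + c * r ^ 2 := by
  have e : -(a * |p * r|) ≤ b * (p * r) := by
    rcases abs_cases (p * r) with h | h <;> rw [h.1] <;> nlinarith
  nlinarith [sq_nonneg r]

theorem aux1 (a u v : ℤ) (ha : 0 < a) (h : 1 ≤ u) (h2 : a * u ≤ v) : a ≤ v := by nlinarith

theorem aux2 (a u : ℤ) (ha : 0 < a) (h : a * u ≤ a) : u ≤ 1 := by nlinarith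

theorem aux3 (r : ℤ) (h : 3 * r ^ 2 ≤ 4) : -1 ≤ r ∧ r ≤ 1 := by constructor <;> nlinarith

theorem small_pr (p r : ℤ) : 0 ≤ p ^ 2 - |p * r| + r ^ 2 ∧
    ((p ≠ 0 ∨ r ≠ 0) → 1 ≤ p ^ 2 - |p * r| + r ^ 2) ∧
    (p ^ 2 - |p * r| + r ^ 2 ≤ 1 → (-1 ≤ p ∧ p ≤ 1 ∧ -1 ≤ r ∧ r ≤ 1)) := by
  have k : 4 * (p ^ 2 - |p * r| + r ^ 2) = (2 * |p| - |r|) ^ 2 + 3 * r ^ 2 := by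
    rw [abs_mul]
    have := sq_abs p
    have := sq_abs r
    nlinarith
  have k' : 4 * (p ^ 2 - |p * r| + r ^ 2) = (2 * |r| - |p|) ^ 2 + 3 * p ^ 2 := by
    rw [abs_mul]
    have := sq_abs p
    have := sq_abs r
    nlinarith
  have s1 := sq_nonneg (2 * |p| - |r|)
  have s2 := sq_nonneg (2 * |r| - |p|)
  refine ⟨by nlinarith [sq_nonneg r], ?_, ?_⟩
  · rintro (h | h)
    · have : 0 < p ^ 2 := by positivity
      omega
    · have : 0 < r ^ 2 := by positivity
      omega
  · intro h
    have t1 := aux3 r (by linarith)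
    have t2 := aux3 p (by linarith)
    exact ⟨t2.1, t2.2, t1.1, t1.2⟩

/-- reducedness of the transformed form, on coordinates -/
def RedP (a b c p q r s : ℤ) : Prop :=
  -(a * p ^ 2 + b * p * r + c * r ^ 2) ≤ 2 * a * p * q + b * (p * s + q * r) + 2 * c * r * s ∧
  2 * a * p * q + b * (p * s + q * r) + 2 * c * r * s ≤ a * p ^ 2 + b * p * r + c * r ^ 2 ∧
  a * p ^ 2 + b * p * r + c * r ^ 2 ≤ a * q ^ 2 + b * q * s + c * s ^ 2

instance (a b c p q r s : ℤ) : Decidable (RedP a b c p q r s) := by unfold RedP; infer_instance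

theorem red_bound (a b c p q r s : ℤ) (ha : 0 < a) (h1 : -a ≤ b) (h2 : b ≤ a) (h3 : a ≤ c)
    (hd : p * s - q * r = 1) (h : RedP a b c p q r s) :
    (-1 ≤ p ∧ p ≤ 1) ∧ (-2 ≤ q ∧ q ≤ 2) ∧ (-1 ≤ r ∧ r ≤ 1) ∧ (-1 ≤ s ∧ s ≤ 1) := by
  obtain ⟨g1, g2, g3⟩ := h
  set a' := a * p ^ 2 + b * p * r + c * r ^ 2 with ha'
  set b' := 2 * a * p * q + b * (p * s + q * r) + 2 * c * r * s with hb'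
  set c' := a * q ^ 2 + b * q * s + c * s ^ 2 with hc'
  have inv : a = a' * s ^ 2 + b' * s * (-r) + c' * (-r) ^ 2 := by
    have : a = a * (p * s - q * r) ^ 2 := by rw [hd]; ring
    rw [ha', hb', hc']
    linear_combination this
  have pr : p ≠ 0 ∨ r ≠ 0 := by
    by_contra hh
    push Not at hh
    rw [hh.1, hh.2] at hd
    simp at hd
  have sr : s ≠ 0 ∨ -r ≠ 0 := by
    by_contra hh
    push Not at hh
    have : r = 0 := by omega
    rw [hh.1, this] at hd
    simp at hd
  have m1 := min_red a b c p r h1 h2 h3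
  obtain ⟨-, n1, n2⟩ := small_pr p r
  have n1 := n1 pr
  have aa : a ≤ a' := aux1 _ _ _ ha n1 m1
  have m2 := min_red a' b' c' s (-r) g1 g2 g3
  rw [← inv] at m2
  obtain ⟨-, n3, n4⟩ := small_pr s (-r)
  have n3 := n3 sr
  have aa' : a' = a := le_antisymm (aux1 _ _ _ (by omega) n3 m2) aa
  rw [← ha', aa'] at m1
  rw [aa'] at m2
  have b1 := n2 (aux2 _ _ ha m1)
  have b2 := n4 (aux2 _ _ ha m2)
  refine ⟨⟨b1.1, b1.2.1⟩, ?_, ⟨b1.2.2.1, b1.2.2.2⟩, ⟨b2.1, b2.2.1⟩⟩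
  have hr := b1.2.2
  have hp := b1
  have hs := b2
  obtain ⟨p1, p2, -⟩ := b1
  obtain ⟨s1, s2, -⟩ := b2
  obtain ⟨r1, r2⟩ := hr
  have hr3 : r = -1 ∨ r = 0 ∨ r = 1 := by omega
  have hp3 : p = -1 ∨ p = 0 ∨ p = 1 := by omega
  have hs3 : s = -1 ∨ s = 0 ∨ s = 1 := by omega
  rcases hr3 with hr | hr | hr
  · rw [hr] at hd
    rcases hp3 with h | h | h <;> rcases hs3 with h' | h' | h' <;> rw [h, h'] at hd <;> omega
  · rw [hr] at hd
    rw [aa'] at g1 g2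
    rw [hb', hr] at g1 g2
    clear m1 m2 inv n1 n2 n3 n4 hp hs aa ha' hc' g3
    rcases hp3 with h | h | h <;> rcases hs3 with h' | h' | h' <;> rw [h, h'] at hd g1 g2 <;>
      first
        | omega
        | (constructor <;> nlinarith)
  · rw [hr] at hd
    rcases hp3 with h | h | h <;> rcases hs3 with h' | h' | h' <;> rw [h, h'] at hd <;> omega

/-- six times the weight of a reduced form -/
def wR (Q : ℤ × ℤ × ℤ) : ℤ :=
  if Q.2.1 = Q.1 ∨ Q.2.1 = -Q.1 then (if Q.1 = Q.2.2 then 1 else 3)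
  else (if Q.1 = Q.2.2 then 3 else 6)

noncomputable def box : Finset (ℤ × ℤ × ℤ × ℤ) :=
  Finset.Icc (-1) 1 ×ˢ Finset.Icc (-2) 2 ×ˢ Finset.Icc (-1) 1 ×ˢ Finset.Icc (-1) 1

noncomputable def redSet (a b c : ℤ) : Finset (ℤ × ℤ × ℤ × ℤ) :=
  box.filter fun v => v.1 * v.2.2.2 - v.2.1 * v.2.2.1 = 1 ∧ RedP a b c v.1 v.2.1 v.2.2.1 v.2.2.2

/-- all unimodular vectors in the box -/
def detBox : List (ℤ × ℤ × ℤ × ℤ) :=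
  [(-1, -2, 1, 1), (1, 2, -1, -1), (-1, 2, -1, 1), (1, -2, 1, -1),
   (-1, -1, 0, -1), (-1, 0, 0, -1), (-1, 1, 0, -1), (1, -1, 0, 1), (1, 0, 0, 1), (1, 1, 0, 1),
   (-1, 0, -1, -1), (-1, 0, 1, -1), (1, 0, -1, 1), (1, 0, 1, 1),
   (0, 1, -1, 0), (0, 1, -1, 1), (0, 1, -1, -1), (0, -1, 1, 0), (0, -1, 1, 1), (0, -1, 1, -1),
   (1, 1, -1, 0), (1, -1, 1, 0), (-1, 1, -1, 0), (-1, -1, 1, 0),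
   (1, 2, 0, 1), (1, -2, 0, 1), (-1, 2, 0, -1), (-1, -2, 0, -1)]

theorem mem_detBox : ∀ v ∈ box, v.1 * v.2.2.2 - v.2.1 * v.2.2.1 = 1 → v ∈ detBox := by
  decide +kernel

theorem redSet_congr (a b c a' b' c' : ℤ)
    (h : ∀ v ∈ detBox, RedP a b c v.1 v.2.1 v.2.2.1 v.2.2.2 ↔
      RedP a' b' c' v.1 v.2.1 v.2.2.1 v.2.2.2) : redSet a b c = redSet a' b' c' := by
  unfold redSet
  apply Finset.filter_congr
  intro v hv
  constructor
  · rintro ⟨h1, h2⟩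
    exact ⟨h1, (h v (mem_detBox v hv h1)).1 h2⟩
  · rintro ⟨h1, h2⟩
    exact ⟨h1, (h v (mem_detBox v hv h1)).2 h2⟩

theorem redSet_card (a b c : ℤ) (ha : 0 < a) (h1 : -a ≤ b) (h2 : b ≤ a) (h3 : a ≤ c) :
    ((redSet a b c).card : ℤ) * wR (a, b, c) = 12 := by
  have T : ∀ b' c' : ℤ, (b = a ↔ b' = 1) → (b = -a ↔ b' = -1) → (a = c ↔ 1 = c') →
      (-1 ≤ b' ∧ b' ≤ 1 ∧ 1 ≤ c') →
      redSet a b c = redSet 1 b' c' ∧ wR (a, b, c) = wR (1, b', c') := by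
    intro b' c' i1 i2 i3 i4
    constructor
    · apply redSet_congr
      intro v hv
      fin_cases hv <;> dsimp only [RedP] <;> omega
    · unfold wR
      dsimp only
      simp only [i1, i2, i3]
  rcases eq_or_ne b a with e1 | e1
  · rcases eq_or_ne a c with e3 | e3
    · obtain ⟨t1, t2⟩ := T 1 1 (by omega) (by omega) (by omega) (by omega)
      rw [t1, t2]; decide +kernel
    · obtain ⟨t1, t2⟩ := T 1 2 (by omega) (by omega) (by omega) (by omega)
      rw [t1, t2]; decide +kernel
  · rcases eq_or_ne b (-a) with e2 | e2 <;> rcases eq_or_ne a c with e3 | e3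
    · obtain ⟨t1, t2⟩ := T (-1) 1 (by omega) (by omega) (by omega) (by omega)
      rw [t1, t2]; decide +kernel
    · obtain ⟨t1, t2⟩ := T (-1) 2 (by omega) (by omega) (by omega) (by omega)
      rw [t1, t2]; decide +kernel
    · obtain ⟨t1, t2⟩ := T 0 1 (by omega) (by omega) (by omega) (by omega)
      rw [t1, t2]; decide +kernel
    · obtain ⟨t1, t2⟩ := T 0 2 (by omega) (by omega) (by omega) (by omega)
      rw [t1, t2]; decide +kernel

theorem redP_act (γ : SL2) (Q : ℤ × ℤ × ℤ) : IsRed (formAct γ Q) ↔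
    RedP Q.1 Q.2.1 Q.2.2 (γ.1 0 0) (γ.1 0 1) (γ.1 1 0) (γ.1 1 1) := by
  rw [act_eq]; rfl

theorem mem_redSet (γ : SL2) (Q : ℤ × ℤ × ℤ) (hp : 0 < Q.1) (hr : IsRed Q) :
    (γ.1 0 0, γ.1 0 1, γ.1 1 0, γ.1 1 1) ∈ redSet Q.1 Q.2.1 Q.2.2 ↔ IsRed (formAct γ Q) := by
  rw [redP_act]
  unfold redSet box
  simp only [Finset.mem_filter, Finset.mem_product, Finset.mem_Icc]
  constructor
  · exact fun h => h.2.2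
  · intro h
    have hd := det_eq γ
    exact ⟨red_bound _ _ _ _ _ _ _ hp hr.1 hr.2.1 hr.2.2 hd h, hd, h⟩

theorem card_red (Q : ℤ × ℤ × ℤ) (hp : 0 < Q.1) (hr : IsRed Q) :
    (Nat.card {γ : SL2 // IsRed (formAct γ Q)} : ℤ) * wR Q = 12 := by
  have key : Nat.card {γ : SL2 // IsRed (formAct γ Q)} = (redSet Q.1 Q.2.1 Q.2.2).card := by
    let F : {γ : SL2 // IsRed (formAct γ Q)} → redSet Q.1 Q.2.1 Q.2.2 := fun γ =>
      ⟨(γ.1.1 0 0, γ.1.1 0 1, γ.1.1 1 0, γ.1.1 1 1), (mem_redSet γ.1 Q hp hr).2 γ.2⟩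
    have hF : Function.Bijective F := by
      constructor
      · intro γ δ h
        have h := congrArg Subtype.val h
        simp only [F, Prod.mk.injEq] at h
        apply Subtype.ext
        apply Subtype.ext
        ext i j
        fin_cases i <;> fin_cases j
        · exact h.1
        · exact h.2.1
        · exact h.2.2.1
        · exact h.2.2.2
      · rintro ⟨⟨p, q, r, s⟩, h⟩
        have h' := h
        unfold redSet at h'
        rw [Finset.mem_filter] at h'
        have hdet : (!![p, q; r, s] : Matrix (Fin 2) (Fin 2) ℤ).det = 1 := by
          rw [Matrix.det_fin_two_of]; exact h'.2.1
        have hm := (mem_redSet ⟨!![p, q; r, s], hdet⟩ Q hp hr).1 h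
        exact ⟨⟨⟨!![p, q; r, s], hdet⟩, hm⟩, rfl⟩
    rw [Nat.card_congr (Equiv.ofBijective F hF), Nat.card_eq_fintype_card, Fintype.card_coe]
  rw [key]
  exact redSet_card _ _ _ hp hr.1 hr.2.1 hr.2.2

theorem wR_act (γ : SL2) (Q : ℤ × ℤ × ℤ) (hp : 0 < Q.1) (hr : IsRed Q)
    (hr' : IsRed (formAct γ Q)) : wR (formAct γ Q) = wR Q := by
  have h1 := (mem_redSet γ Q hp hr).2 hr'
  unfold redSet at h1
  rw [Finset.mem_filter] at h1
  obtain ⟨h1, h2, h3⟩ := h1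
  have h4 := mem_detBox _ h1 h2
  have hd := det_eq γ
  obtain ⟨a, b, c⟩ := Q
  obtain ⟨g1, g2, g3⟩ := hr
  rw [act_eq]
  dsimp only at *
  generalize γ.1 0 0 = p at *
  generalize γ.1 0 1 = q at *
  generalize γ.1 1 0 = r at *
  generalize γ.1 1 1 = s at *
  have key : a * p ^ 2 + b * p * r + c * r ^ 2 = a ∧ a * q ^ 2 + b * q * s + c * s ^ 2 = c ∧
    (2 * a * p * q + b * (p * s + q * r) + 2 * c * r * s = b ∨
      2 * a * p * q + b * (p * s + q * r) + 2 * c * r * s = -b) := by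
    unfold RedP at h3
    simp only [detBox, List.mem_cons, Prod.mk.injEq, List.not_mem_nil, or_false] at h4
    rcases h4 with h | h | h | h | h | h | h | h | h | h | h | h | h | h | h | h | h | h | h | h |
      h | h | h | h | h | h | h | h <;> obtain ⟨rfl, rfl, rfl, rfl⟩ := h <;> omega
  obtain ⟨k1, k2, k3⟩ := key
  rw [k1, k2]
  unfold wR
  dsimp only
  rcases k3 with k3 | k3 <;> rw [k3]
  have : (-b = a ∨ -b = -a) ↔ (b = a ∨ b = -a) := by omega
  simp only [this]


/-! ### Class numbers -/

def Tm (k : ℤ) : SL2 := ⟨!![1, k; 0, 1], by rw [Matrix.det_fin_two_of]; ring⟩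

def Sm : SL2 := ⟨!![0, -1; 1, 0], by rw [Matrix.det_fin_two_of]; ring⟩

theorem act_Tm (k a b c : ℤ) :
    formAct (Tm k) (a, b, c) = (a, 2 * a * k + b, a * k ^ 2 + b * k + c) := by
  rw [act_eq]
  simp [Tm]

theorem act_Sm (a b c : ℤ) : formAct Sm (a, b, c) = (c, -b, a) := by
  rw [act_eq]
  simp [Sm]

theorem exists_red (Q : ℤ × ℤ × ℤ) (h : IsPosDef Q) : ∃ γ : SL2, IsRed (formAct γ Q) := by
  classical
  have ex : ∃ m : ℕ, ∃ γ : SL2, ((formAct γ Q).1).toNat = m := ⟨_, 1, rfl⟩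
  obtain ⟨γ, hγ⟩ := Nat.find_spec ex
  have hmin : ∀ δ : SL2, (formAct γ Q).1 ≤ (formAct δ Q).1 := by
    intro δ
    have h1 := Nat.find_min' ex ⟨δ, rfl⟩
    rw [← hγ] at h1
    have h2 := (posDef_act γ Q h).1
    have h3 := (posDef_act δ Q h).1
    omega
  have hp := (posDef_act γ Q h).1
  rcases hQ : formAct γ Q with ⟨a, b, c⟩
  rw [hQ] at hmin hp
  dsimp only at hmin hp
  -- translate
  refine ⟨γ * Tm (-((b + a) / (2 * a))), ?_⟩
  have e1 := hmin (γ * Tm (-((b + a) / (2 * a))) * Sm)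
  rw [← act_mul, ← act_mul, hQ, act_Tm, act_Sm] at e1
  rw [← act_mul, hQ, act_Tm]
  have d1 := Int.emod_add_mul_ediv (b + a) (2 * a)
  have d2 := Int.emod_nonneg (b + a) (show 2 * a ≠ 0 by omega)
  have d3 := Int.emod_lt_of_pos (b + a) (show 0 < 2 * a by omega)
  have d4 : 2 * a * (-((b + a) / (2 * a))) + b = (b + a) % (2 * a) - a := by linarith
  refine ⟨?_, ?_, e1⟩
  · dsimp only; rw [d4]; omega
  · dsimp only; rw [d4]; omega

abbrev XN (N : ℤ) := {Q : ℤ × ℤ × ℤ // formDisc Q = -N ∧ IsPosDef Q}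

def relN (N : ℤ) (Q Q' : XN N) : Prop := ∃ γ : SL2, formAct γ Q.1 = Q'.1

theorem relN_equiv (N : ℤ) : Equivalence (relN N) := by
  refine ⟨fun Q => ⟨1, act_one _⟩, ?_, ?_⟩
  · rintro Q Q' ⟨γ, h⟩
    exact ⟨γ⁻¹, by rw [← h, act_mul, mul_inv_cancel, act_one]⟩
  · rintro Q Q' Q'' ⟨γ, h⟩ ⟨δ, h'⟩
    exact ⟨γ * δ, by rw [← act_mul, h, h']⟩

theorem mk_eq_iff (N : ℤ) (Q Q' : XN N) :
    (Quot.mk _ Q : FormClasses N) = Quot.mk _ Q' ↔ relN N Q Q' := by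
  constructor
  · intro h
    exact (Equivalence.eqvGen_iff (relN_equiv N)).1 (Quot.eqvGen_exact h)
  · intro h
    exact Quot.sound h

abbrev DN (N : ℤ) := {Q : XN N // IsRed Q.1}

noncomputable def cubeN (N : ℤ) : Finset (ℤ × ℤ × ℤ) :=
  Finset.Icc 1 N ×ˢ Finset.Icc (-N) N ×ˢ Finset.Icc 1 N

theorem bound_abc (N a b c : ℤ) (ha : 0 < a) (hc : 0 < c) (h : b ^ 2 - 4 * a * c = -N)
    (h1 : |b| ≤ a) (h2 : |b| ≤ c) : a ≤ N ∧ c ≤ N ∧ -N ≤ b ∧ b ≤ N := by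
  have h3 : b ^ 2 ≤ a * c := by
    rw [← sq_abs, sq]
    exact mul_le_mul h1 h2 (abs_nonneg _) ha.le
  have h4 : 3 * (a * c) ≤ N := by nlinarith
  have h5 : a ≤ a * c := by nlinarith
  have h6 : c ≤ a * c := by nlinarith
  have := abs_le.1 h1
  refine ⟨by omega, by omega, by omega, by omega⟩

theorem DN_finite (N : ℤ) : Finite (DN N) := by
  let F : DN N → cubeN N := fun Q => ⟨Q.1.1, by
    obtain ⟨⟨⟨a, b, c⟩, h1, h2⟩, h3⟩ := Q
    obtain ⟨r1, r2, r3⟩ := h3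
    obtain ⟨p1, -⟩ := h2
    have r1 : -a ≤ b := r1
    have r2 : b ≤ a := r2
    have r3 : a ≤ c := r3
    have p1 : 0 < a := p1
    have h1 : b ^ 2 - 4 * a * c = -N := h1
    change (a, b, c) ∈ cubeN N
    have := bound_abc N a b c p1 (by omega) h1 (abs_le.2 ⟨r1, r2⟩) (abs_le.2 ⟨by omega, by omega⟩)
    simp only [cubeN, Finset.mem_product, Finset.mem_Icc]
    omega⟩
  apply Finite.of_injective F
  intro Q Q' h
  have := congrArg Subtype.val h
  exact Subtype.ext (Subtype.ext this)

noncomputable instance (N : ℤ) : Fintype (DN N) := @Fintype.ofFinite _ (DN_finite N)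

def clN (N : ℤ) (Q : DN N) : FormClasses N := Quot.mk _ Q.1

theorem clN_surj (N : ℤ) : Function.Surjective (clN N) := by
  intro c
  induction c using Quot.ind with
  | mk Q =>
    obtain ⟨γ, h⟩ := exists_red Q.1 Q.2.2
    refine ⟨⟨⟨formAct γ Q.1, by rw [disc_act]; exact Q.2.1, posDef_act _ _ Q.2.2⟩, h⟩, ?_⟩
    exact ((mk_eq_iff N _ _).2 ⟨γ, rfl⟩).symm

noncomputable instance (N : ℤ) : Fintype (FormClasses N) := by
  classical
  exact @Fintype.ofFinite _ (Finite.of_surjective _ (clN_surj N))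

/-- all reductions of `R` correspond to pairs (reduced form in the class, stabiliser element) -/
theorem card_prod (N : ℤ) (R : XN N) (c : FormClasses N) (hc : c = Quot.mk _ R) :
    Nat.card {γ : SL2 // IsRed (formAct γ R.1)}
      = Nat.card {Q : DN N // clN N Q = c} * Nat.card {γ : SL2 // formAct γ R.1 = R.1} := by
  rw [← Nat.card_prod]
  have ex : ∀ Q : {Q : DN N // clN N Q = c}, ∃ γ : SL2, formAct γ R.1 = Q.1.1.1 := by
    rintro ⟨Q, hQ⟩
    rw [hc] at hQ
    exact (mk_eq_iff N _ _).1 hQ.symm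
  choose g hg using ex
  symm
  apply Nat.card_congr
  refine Equiv.ofBijective (fun q => ⟨q.2.1 * g q.1, ?_⟩) ⟨?_, ?_⟩
  · rw [← act_mul, q.2.2, hg]
    exact q.1.1.2
  · rintro ⟨Q, s⟩ ⟨Q', s'⟩ h
    have h := congrArg Subtype.val h
    dsimp only at h
    have e : Q = Q' := by
      have h2 : formAct (s.1 * g Q) R.1 = formAct (s'.1 * g Q') R.1 := by rw [h]
      rw [← act_mul, s.2, hg, ← act_mul, s'.2, hg] at h2
      exact Subtype.ext (Subtype.ext (Subtype.ext h2))
    subst e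
    have := mul_right_cancel h
    rw [Subtype.ext this]
  · rintro ⟨γ, h⟩
    let Q : {Q : DN N // clN N Q = c} :=
      ⟨⟨⟨formAct γ R.1, by rw [disc_act]; exact R.2.1, posDef_act _ _ R.2.2⟩, h⟩, by
        rw [hc]; exact ((mk_eq_iff N _ _).2 ⟨γ, rfl⟩).symm⟩
    have hQ : formAct (g Q) R.1 = formAct γ R.1 := hg Q
    refine ⟨(Q, ⟨γ * (g Q)⁻¹, ?_⟩), ?_⟩
    · rw [← act_mul, ← hQ, act_mul, mul_inv_cancel, act_one]
    · apply Subtype.ext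
      dsimp only
      rw [inv_mul_cancel_right]

theorem card_trans (δ : SL2) (R : ℤ × ℤ × ℤ) :
    Nat.card {γ : SL2 // IsRed (formAct γ R)}
      = Nat.card {γ : SL2 // IsRed (formAct γ (formAct δ R))} := by
  symm
  apply Nat.card_congr
  refine (Equiv.mulLeft δ).subtypeEquiv ?_
  intro γ
  rw [act_mul]
  rfl

theorem class_weight (N : ℤ) (c : FormClasses N) [Fintype {Q : DN N // clN N Q = c}] :
    6 * ((2 : ℝ) / (Nat.card {γ : SL2 // formAct γ c.out.1 = c.out.1}))
      = ∑ Q : {Q : DN N // clN N Q = c}, ((wR Q.1.1.1 : ℤ) : ℝ) := by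
  obtain ⟨Q0, h0⟩ := clN_surj N c
  have hout : c = Quot.mk _ c.out := (Quot.out_eq c).symm
  have h1 := card_prod N c.out c hout
  obtain ⟨δ, hδ⟩ : relN N c.out Q0.1 := by
    rw [← mk_eq_iff, ← hout]
    exact h0.symm
  rw [card_trans δ, hδ] at h1
  have h2 := card_red Q0.1.1 Q0.1.2.2.1 Q0.2
  have h3 : ∀ Q : {Q : DN N // clN N Q = c}, wR Q.1.1.1 = wR Q0.1.1 := by
    rintro ⟨Q, hQ⟩
    obtain ⟨γ, hγ⟩ : relN N Q0.1 Q.1 := by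
      rw [← mk_eq_iff]
      exact h0.trans hQ.symm
    have := wR_act γ Q0.1.1 Q0.1.2.2.1 Q0.2 (by rw [hγ]; exact Q.2)
    rw [hγ] at this
    exact this
  simp only [h3]
  rw [Finset.sum_const, Finset.card_univ, ← Nat.card_eq_fintype_card, nsmul_eq_mul]
  rw [h1] at h2
  have h4 : ((Nat.card {Q : DN N // clN N Q = c} : ℝ)
    * (Nat.card {γ : SL2 // formAct γ c.out.1 = c.out.1} : ℝ)) * (wR Q0.1.1 : ℤ) = 12 := by
    exact_mod_cast h2
  have h5 : (Nat.card {γ : SL2 // formAct γ c.out.1 = c.out.1} : ℝ) ≠ 0 := by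
    intro h
    rw [h] at h4
    norm_num at h4
  field_simp
  linarith

theorem hurw_red (N : ℤ) (hN : 0 < N) :
    6 * hurwitzClassNumber N = ∑ Q : DN N, ((wR Q.1.1 : ℤ) : ℝ) := by
  classical
  unfold hurwitzClassNumber
  rw [if_neg (by omega), finsum_eq_sum_of_fintype, Finset.mul_sum,
    ← Fintype.sum_fiberwise (clN N)]
  apply Finset.sum_congr rfl
  intro c _
  rw [class_weight]

/-- forms with `|b| ≤ a, c` -/
noncomputable def FN (N : ℤ) : Finset (ℤ × ℤ × ℤ) :=
  (cubeN N).filter fun Q => formDisc Q = -N ∧ |Q.2.1| ≤ Q.1 ∧ |Q.2.1| ≤ Q.2.2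

theorem mem_FN (N a b c : ℤ) : (a, b, c) ∈ FN N ↔
    0 < a ∧ 0 < c ∧ b ^ 2 - 4 * a * c = -N ∧ |b| ≤ a ∧ |b| ≤ c := by
  unfold FN cubeN formDisc
  simp only [Finset.mem_filter, Finset.mem_product, Finset.mem_Icc]
  constructor
  · rintro ⟨⟨h1, h2, h3⟩, h4, h5, h6⟩
    exact ⟨by omega, by omega, h4, h5, h6⟩
  · rintro ⟨h1, h2, h3, h4, h5⟩
    have := bound_abc N a b c h1 h2 h3 h4 h5
    exact ⟨⟨⟨by omega, by omega⟩, ⟨by omega, by omega⟩, ⟨by omega, by omega⟩⟩, h3, h4, h5⟩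

theorem hurw_W6 (N : ℤ) (hN : 0 < N) :
    12 * hurwitzClassNumber N = ((∑ Q ∈ FN N, W6 Q.2.1 Q.1 Q.2.2 : ℤ) : ℝ) := by
  have e1 : ∑ Q : DN N, ((wR Q.1.1 : ℤ) : ℝ)
      = ((∑ Q ∈ FN N, (if Q.1 ≤ Q.2.2 then wR Q else 0) : ℤ) : ℝ) := by
    rw [← Finset.sum_filter]
    push_cast
    refine Finset.sum_bij (fun Q _ => Q.1.1) ?_ ?_ ?_ ?_
    · rintro ⟨⟨⟨a, b, c⟩, h1, h2⟩, h3⟩ _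
      obtain ⟨r1, r2, r3⟩ := h3
      obtain ⟨p1, -⟩ := h2
      have r1 : -a ≤ b := r1
      have r2 : b ≤ a := r2
      have r3 : a ≤ c := r3
      have p1 : 0 < a := p1
      have h1 : b ^ 2 - 4 * a * c = -N := h1
      change (a, b, c) ∈ _
      rw [Finset.mem_filter, mem_FN]
      exact ⟨⟨p1, by omega, h1, abs_le.2 ⟨r1, r2⟩, abs_le.2 ⟨by omega, by omega⟩⟩, r3⟩
    · intro Q _ Q' _ h
      exact Subtype.ext (Subtype.ext h)
    · rintro ⟨a, b, c⟩ h
      rw [Finset.mem_filter, mem_FN] at h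
      obtain ⟨⟨h1, h2, h3, h4, h5⟩, h6⟩ := h
      have h7 := abs_le.1 h4
      exact ⟨⟨⟨(a, b, c), h3, h1, by unfold formDisc; dsimp only; omega⟩, h7.1, h7.2, h6⟩,
        Finset.mem_univ _, rfl⟩
    · intro Q _
      rfl
  have e2 : ∑ Q ∈ FN N, (if Q.2.2 ≤ Q.1 then wR (Q.2.2, Q.2.1, Q.1) else 0)
      = ∑ Q ∈ FN N, (if Q.1 ≤ Q.2.2 then wR Q else 0) := by
    refine Finset.sum_nbij' (fun Q => (Q.2.2, Q.2.1, Q.1)) (fun Q => (Q.2.2, Q.2.1, Q.1))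
      ?_ ?_ ?_ ?_ ?_
    · rintro ⟨a, b, c⟩ h
      rw [mem_FN] at *
      obtain ⟨h1, h2, h3, h4, h5⟩ := h
      exact ⟨h2, h1, by linarith, h5, h4⟩
    · rintro ⟨a, b, c⟩ h
      rw [mem_FN] at *
      obtain ⟨h1, h2, h3, h4, h5⟩ := h
      exact ⟨h2, h1, by linarith, h5, h4⟩
    · simp
    · simp
    · simp
  have e3 : ∑ Q ∈ FN N, W6 Q.2.1 Q.1 Q.2.2 = ∑ Q ∈ FN N, (if Q.1 ≤ Q.2.2 then wR Q else 0)
      + ∑ Q ∈ FN N, (if Q.2.2 ≤ Q.1 then wR (Q.2.2, Q.2.1, Q.1) else 0) := by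
    rw [← Finset.sum_add_distrib]
    apply Finset.sum_congr rfl
    rintro ⟨a, b, c⟩ h
    rw [mem_FN] at h
    obtain ⟨h1, h2, -, h4, h5⟩ := h
    unfold W6 wR
    dsimp only
    have hb : (b = a ∨ b = -a) ↔ |b| = a := by
      rcases abs_cases b with h | h <;> omega
    have hc : (b = c ∨ b = -c) ↔ |b| = c := by
      rcases abs_cases b with h | h <;> omega
    rw [if_congr hb rfl rfl, if_congr hc rfl rfl]
    generalize |b| = β at *
    clear hb hc
    split_ifs <;> omega
  rw [e3, e2, Int.cast_add, ← e1, ← hurw_red N hN]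
  ring


/-! ### Quadruples and class numbers -/

noncomputable def RR (n : ℕ) : Finset Z4 :=
  (Finset.Icc (-(2 * n) : ℤ) (2 * n) ×ˢ Finset.Icc (-(2 * n) : ℤ) (2 * n) ×ˢ
    Finset.Icc (1 : ℤ) (2 * n) ×ˢ Finset.Icc (1 : ℤ) (2 * n)).filter fun m =>
      |m.1 - m.2.1| ≤ m.2.2.1 ∧ |m.1 - m.2.1| ≤ m.2.2.2 ∧ m.1 * m.2.1 + m.2.2.1 * m.2.2.2 = n

theorem RR_bound (n x y B c : ℤ) (hn : 0 ≤ n) (hB : 0 < B) (hc : 0 < c) (h1 : |x - y| ≤ B)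
    (h2 : |x - y| ≤ c) (h : x * y + B * c = n) :
    B ≤ 2 * n ∧ c ≤ 2 * n ∧ -(2 * n) ≤ x + y ∧ x + y ≤ 2 * n := by
  have h3 : (x - y) ^ 2 ≤ B * c := by
    rw [← sq_abs, sq]
    exact mul_le_mul h1 h2 (abs_nonneg _) hB.le
  have h4 : (x + y) ^ 2 + 3 * (B * c) ≤ 4 * n := by nlinarith
  have h5 : B ≤ B * c := by nlinarith
  have h6 : c ≤ B * c := by nlinarith
  have h7 := sq_nonneg (x + y)
  have h8 : 1 ≤ n := by nlinarith
  have h9 : |x + y| ≤ |2 * n| := by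
    apply sq_le_sq.1
    nlinarith
  rw [abs_of_nonneg (show 0 ≤ 2 * n by omega), abs_le] at h9
  refine ⟨by omega, by omega, h9.1, h9.2⟩

theorem mem_RR {n : ℕ} {x y B c : ℤ} : (x, y, B, c) ∈ RR n ↔
    0 < B ∧ 0 < c ∧ |x - y| ≤ B ∧ |x - y| ≤ c ∧ x * y + B * c = n := by
  simp only [RR, Finset.mem_filter, Finset.mem_product, Finset.mem_Icc]
  constructor
  · rintro ⟨⟨-, -, h1, h2⟩, h3, h4, h5⟩
    exact ⟨by omega, by omega, h3, h4, h5⟩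
  · rintro ⟨h1, h2, h3, h4, h5⟩
    have b := RR_bound n x y B c (by omega) h1 h2 h3 h4 h5
    have a := abs_le.1 h3
    exact ⟨⟨by omega, by omega, by omega, by omega⟩, h3, h4, h5⟩

theorem sum_FN_RR (n : ℕ) :
    ∑ t ∈ Finset.Icc (-(2 * n) : ℤ) (2 * n), ∑ Q ∈ FN (4 * n - t ^ 2), W6 Q.2.1 Q.1 Q.2.2 * f3 t
      = ∑ m ∈ RR n, W6 (m.1 - m.2.1) m.2.2.1 m.2.2.2 * f3 (m.1 + m.2.1) := by
  rw [Finset.sum_sigma']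
  have par : ∀ t b m : ℤ, t ^ 2 - b ^ 2 = 4 * m → t % 2 = b % 2 := by
    intro t b m h
    have h2 : (t - b) * (t + b) = 2 * (2 * m) := by linarith
    rcases Int.emod_two_eq_zero_or_one t with h3 | h3 <;>
      rcases Int.emod_two_eq_zero_or_one b with h4 | h4
    · omega
    · exfalso
      have : ((t - b) * (t + b)) % 2 = 1 := by
        rw [Int.mul_emod, show (t - b) % 2 = 1 by omega, show (t + b) % 2 = 1 by omega]; rfl
      omega
    · exfalso
      have : ((t - b) * (t + b)) % 2 = 1 := by
        rw [Int.mul_emod, show (t - b) % 2 = 1 by omega, show (t + b) % 2 = 1 by omega]; rfl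
      omega
    · omega
  refine Finset.sum_nbij' (fun s => ((s.1 + s.2.2.1) / 2, (s.1 - s.2.2.1) / 2, s.2.1, s.2.2.2))
    (fun m => ⟨m.1 + m.2.1, (m.2.2.1, m.1 - m.2.1, m.2.2.2)⟩) ?_ ?_ ?_ ?_ ?_
  · rintro ⟨t, a, b, c⟩ h
    rw [Finset.mem_sigma, mem_FN] at h
    obtain ⟨-, h1, h2, h3, h4, h5⟩ := h
    dsimp only at *
    have p := par t b (n - a * c) (by linarith)
    obtain ⟨x, hx⟩ : ∃ x, t + b = 2 * x := ⟨(t + b) / 2, by omega⟩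
    obtain ⟨y, hy⟩ : ∃ y, t - b = 2 * y := ⟨(t - b) / 2, by omega⟩
    rw [show (t + b) / 2 = x by omega, show (t - b) / 2 = y by omega, mem_RR]
    obtain rfl : b = x - y := by omega
    obtain rfl : t = x + y := by omega
    exact ⟨h1, h2, h4, h5, by linarith⟩
  · rintro ⟨x, y, B, c⟩ h
    rw [mem_RR] at h
    obtain ⟨h1, h2, h3, h4, h5⟩ := h
    have b := RR_bound n x y B c (by omega) h1 h2 h3 h4 h5
    rw [Finset.mem_sigma, mem_FN, Finset.mem_Icc]
    exact ⟨⟨b.2.2.1, b.2.2.2⟩, h1, h2, by linarith, h3, h4⟩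
  · rintro ⟨t, a, b, c⟩ h
    rw [Finset.mem_sigma, mem_FN] at h
    obtain ⟨-, h1, h2, h3, h4, h5⟩ := h
    dsimp only at *
    have p := par t b (n - a * c) (by linarith)
    rw [show (t + b) / 2 + (t - b) / 2 = t by omega, show (t + b) / 2 - (t - b) / 2 = b by omega]
  · rintro ⟨x, y, B, c⟩ h
    dsimp only
    rw [show (x + y + (x - y)) / 2 = x by omega, show (x + y - (x - y)) / 2 = y by omega]
  · rintro ⟨t, a, b, c⟩ h
    rw [Finset.mem_sigma, mem_FN] at h
    obtain ⟨-, h1, h2, h3, h4, h5⟩ := h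
    dsimp only at *
    have p := par t b (n - a * c) (by linarith)
    rw [show (t + b) / 2 + (t - b) / 2 = t by omega, show (t + b) / 2 - (t - b) / 2 = b by omega]

def FR (m : Z4) : ℤ := W6 (m.1 - m.2.1) m.2.2.1 m.2.2.2 * f3 (m.1 + m.2.1)

theorem W6_neg (b B c : ℤ) : W6 (-b) B c = W6 b B c := by unfold W6; rw [abs_neg]

theorem f3_neg (s : ℤ) : f3 (-s) = f3 s := by
  rw [f3_eq, f3_eq, neg_sq]
  exact if_congr (by omega) rfl rfl

theorem FR_neg (x y B c : ℤ) : FR (-x, -y, B, c) = FR (x, y, B, c) := by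
  unfold FR
  dsimp only
  rw [← W6_neg, ← f3_neg]
  congr 2 <;> ring

theorem FR_swap (x y B c : ℤ) : FR (y, x, B, c) = FR (x, y, B, c) := by
  unfold FR
  dsimp only
  rw [← W6_neg, add_comm]
  congr 2; ring

theorem RR_neg_sum (n : ℕ) (p q : ℤ → ℤ → Prop) [∀ x y, Decidable (p x y)]
    [∀ x y, Decidable (q x y)] (h : ∀ x y, p x y ↔ q (-x) (-y)) :
    ∑ m ∈ RR n, (if p m.1 m.2.1 then FR m else 0) = ∑ m ∈ RR n, if q m.1 m.2.1 then FR m else 0 := by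
  refine Finset.sum_nbij' (fun m => (-m.1, -m.2.1, m.2.2.1, m.2.2.2))
    (fun m => (-m.1, -m.2.1, m.2.2.1, m.2.2.2)) ?_ ?_ ?_ ?_ ?_
  · rintro ⟨x, y, B, c⟩ h
    rw [mem_RR] at h ⊢
    rw [show -x - -y = -(x - y) by ring, abs_neg, neg_mul_neg]
    exact h
  · rintro ⟨x, y, B, c⟩ h
    rw [mem_RR] at h ⊢
    rw [show -x - -y = -(x - y) by ring, abs_neg, neg_mul_neg]
    exact h
  · simp
  · simp
  · rintro ⟨x, y, B, c⟩ _
    dsimp only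
    rw [FR_neg]
    exact if_congr (h x y) rfl rfl

theorem RR_swap_sum (n : ℕ) (p q : ℤ → ℤ → Prop) [∀ x y, Decidable (p x y)]
    [∀ x y, Decidable (q x y)] (h : ∀ x y, p x y ↔ q y x) :
    ∑ m ∈ RR n, (if p m.1 m.2.1 then FR m else 0) = ∑ m ∈ RR n, if q m.1 m.2.1 then FR m else 0 := by
  refine Finset.sum_nbij' (fun m => (m.2.1, m.1, m.2.2.1, m.2.2.2))
    (fun m => (m.2.1, m.1, m.2.2.1, m.2.2.2)) ?_ ?_ ?_ ?_ ?_
  · rintro ⟨x, y, B, c⟩ h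
    rw [mem_RR] at h ⊢
    rw [abs_sub_comm, mul_comm]
    exact h
  · rintro ⟨x, y, B, c⟩ h
    rw [mem_RR] at h ⊢
    rw [abs_sub_comm, mul_comm]
    exact h
  · simp
  · simp
  · rintro ⟨x, y, B, c⟩ _
    dsimp only
    rw [FR_swap]
    exact if_congr (h x y) rfl rfl

theorem RR_split (n : ℕ) : ∑ m ∈ RR n, FR m
    = 2 * ∑ m ∈ RR n, (if 0 < m.1 ∧ 0 < m.2.1 then FR m else 0)
      + 2 * ∑ m ∈ RR n, (if 0 < m.1 ∧ m.2.1 < 0 then FR m else 0)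
      + 4 * ∑ m ∈ RR n, (if 0 < m.1 ∧ m.2.1 = 0 then FR m else 0) := by
  have e1 := RR_neg_sum n (fun x y => x < 0 ∧ y < 0) (fun x y => 0 < x ∧ 0 < y)
    (fun x y => by omega)
  have e2 := RR_neg_sum n (fun x y => x < 0 ∧ 0 < y) (fun x y => 0 < x ∧ y < 0)
    (fun x y => by omega)
  have e3 := RR_neg_sum n (fun x y => x < 0 ∧ y = 0) (fun x y => 0 < x ∧ y = 0)
    (fun x y => by omega)
  have e4 := RR_swap_sum n (fun x y => x = 0 ∧ 0 < y) (fun x y => 0 < x ∧ y = 0)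
    (fun x y => by omega)
  have e5 := RR_swap_sum n (fun x y => x = 0 ∧ y < 0) (fun x y => x < 0 ∧ y = 0)
    (fun x y => by omega)
  have key : ∑ m ∈ RR n, FR m =
      ∑ m ∈ RR n, (if 0 < m.1 ∧ 0 < m.2.1 then FR m else 0)
      + ∑ m ∈ RR n, (if m.1 < 0 ∧ m.2.1 < 0 then FR m else 0)
      + ∑ m ∈ RR n, (if 0 < m.1 ∧ m.2.1 < 0 then FR m else 0)
      + ∑ m ∈ RR n, (if m.1 < 0 ∧ 0 < m.2.1 then FR m else 0)
      + ∑ m ∈ RR n, (if 0 < m.1 ∧ m.2.1 = 0 then FR m else 0)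
      + ∑ m ∈ RR n, (if m.1 < 0 ∧ m.2.1 = 0 then FR m else 0)
      + ∑ m ∈ RR n, (if m.1 = 0 ∧ 0 < m.2.1 then FR m else 0)
      + ∑ m ∈ RR n, (if m.1 = 0 ∧ m.2.1 < 0 then FR m else 0) := by
    simp only [← Finset.sum_add_distrib]
    apply Finset.sum_congr rfl
    rintro ⟨x, y, B, c⟩ _
    have h0 : x = 0 → y = 0 → FR (x, y, B, c) = 0 := by
      rintro rfl rfl
      unfold FR
      rw [f3_eq]
      simp
    dsimp only
    generalize FR (x, y, B, c) = F at *
    rcases lt_trichotomy x 0 with hx | hx | hx <;> rcases lt_trichotomy y 0 with hy | hy | hy <;>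
      simp [hx, hy, not_lt_of_gt, ne_of_lt, ne_of_gt, h0]
  rw [key, e1, e2, e5, e3, e4]
  ring

theorem W6_ne (b B c : ℤ) (h : W6 b B c ≠ 0) : |b| ≤ B ∧ |b| ≤ c := by
  unfold W6 at h
  split_ifs at h with h1 h2
  · omega
  · exact h2
  · exact h2
  · exact absurd rfl h

theorem zg_two_iff {t : ℤ} : zg t = 2 ↔ 0 < t := by
  rcases zg_cases t with h | h | h <;> omega

theorem zg_zero_iff {t : ℤ} : zg t = 0 ↔ t < 0 := by
  rcases zg_cases t with h | h | h <;> omega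

theorem w1_eq (x y B c : ℤ) : w1C (cmpOf x y B c) = W6 (x - y) B c := by
  unfold w1C W6 cmpOf
  simp only [zg_two_iff, zg_one]
  have h : |x - y| = x - y ∧ 0 ≤ x - y ∨ |x - y| = -(x - y) ∧ x - y < 0 := abs_cases _
  generalize |x - y| = β at *
  split_ifs <;> omega

theorem part_pp (n : ℕ) : ∑ m ∈ RR n, (if 0 < m.1 ∧ 0 < m.2.1 then FR m else 0)
    = ∑ m ∈ PP n, w1C (cmpOf m.1 m.2.1 m.2.2.1 m.2.2.2) * f3 (m.1 + m.2.1) := by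
  rw [← Finset.sum_filter]
  have : ∀ m ∈ PP n, w1C (cmpOf m.1 m.2.1 m.2.2.1 m.2.2.2) * f3 (m.1 + m.2.1) = FR m := by
    intro m _
    rw [w1_eq]; rfl
  rw [Finset.sum_congr rfl this]
  apply Finset.sum_subset
  · rintro ⟨x, y, B, c⟩ h
    rw [Finset.mem_filter, mem_RR] at h
    rw [mem_PP]
    exact ⟨h.2.1, h.2.2, h.1.1, h.1.2.1, h.1.2.2.2.2⟩
  · rintro ⟨x, y, B, c⟩ h h'
    rw [mem_PP] at h
    rw [Finset.mem_filter, mem_RR] at h'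
    by_contra h0
    have h1 := W6_ne _ _ _ (left_ne_zero_of_mul h0)
    exact h' ⟨⟨h.2.2.1, h.2.2.2.1, h1.1, h1.2, h.2.2.2.2⟩, h.1, h.2.1⟩

theorem w2_eq (x y B c : ℤ) (h1 : 0 < x) (h2 : y < 0) (hb : x - y ≤ B) (hc : x - y ≤ c) :
    w2C (cmpOf c (B - x) (c + y) x) = W6 (x - y) B c := by
  unfold w2C W6 cmpOf
  dsimp only
  rw [abs_of_nonneg (by omega)]
  simp only [zg_two_iff, zg_one, zg_zero_iff, ne_eq]
  split_ifs <;> omega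

theorem w2_ne (x y B c : ℤ) (h : w2C (cmpOf x y B c) ≠ 0) : c ≤ B ∧ B < x ∧ x ≤ B + y := by
  unfold w2C cmpOf at h
  dsimp only at h
  simp only [zg_two_iff, zg_one, zg_zero_iff, ne_eq] at h
  have : ¬ (B - c < 0 ∨ ¬ B - x < 0 ∨ 0 < x - y - B) := by
    intro h'
    rw [if_pos h'] at h
    exact h rfl
  omega

theorem part_pn (n : ℕ) : ∑ m ∈ RR n, (if 0 < m.1 ∧ m.2.1 < 0 then FR m else 0)
    = ∑ m ∈ PP n, w2C (cmpOf m.1 m.2.1 m.2.2.1 m.2.2.2) * f3 (m.2.2.2 + m.2.2.1 - m.1) := by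
  rw [← Finset.sum_filter]
  have e : ∑ m ∈ PP n, w2C (cmpOf m.1 m.2.1 m.2.2.1 m.2.2.2) * f3 (m.2.2.2 + m.2.2.1 - m.1)
    = ∑ m ∈ (PP n).filter (fun m => m.2.2.2 ≤ m.2.2.1 ∧ m.2.2.1 < m.1 ∧ m.1 ≤ m.2.2.1 + m.2.1),
        w2C (cmpOf m.1 m.2.1 m.2.2.1 m.2.2.2) * f3 (m.2.2.2 + m.2.2.1 - m.1) := by
    symm
    apply Finset.sum_filter_of_ne
    intro m _ h
    exact w2_ne _ _ _ _ (left_ne_zero_of_mul h)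
  rw [e]
  refine Finset.sum_nbij' (fun m => (m.2.2.2, m.2.2.1 - m.1, m.2.2.2 + m.2.1, m.1))
    (fun m => (m.2.2.2, m.2.2.1 - m.1, m.2.1 + m.2.2.2, m.1)) ?_ ?_ ?_ ?_ ?_
  · rintro ⟨x, y, B, c⟩ h
    rw [Finset.mem_filter, mem_RR] at h
    rw [Finset.mem_filter, mem_PP]
    obtain ⟨⟨h1, h2, h3, h4, h5⟩, h6, h7⟩ := h
    dsimp only at *
    rw [abs_of_nonneg (by omega)] at h3 h4
    refine ⟨⟨h2, by omega, by omega, h6, ?_⟩, by omega, by omega, by omega⟩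
    rw [← h5]; ring
  · rintro ⟨x, y, B, c⟩ h
    rw [Finset.mem_filter, mem_PP] at h
    rw [Finset.mem_filter, mem_RR]
    obtain ⟨⟨h1, h2, h3, h4, h5⟩, h6, h7, h8⟩ := h
    dsimp only at *
    rw [abs_of_nonneg (by omega)]
    refine ⟨⟨by omega, h1, by omega, by omega, ?_⟩, h4, by omega⟩
    rw [← h5]; ring
  · rintro ⟨x, y, B, c⟩ h
    dsimp only
    congr 2
    · ring
    · congr 1; ring
  · rintro ⟨x, y, B, c⟩ h
    dsimp only
    congr 2
    · ring
    · congr 1; ring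
  · rintro ⟨x, y, B, c⟩ h
    rw [Finset.mem_filter, mem_RR] at h
    obtain ⟨⟨h1, h2, h3, h4, h5⟩, h6, h7⟩ := h
    dsimp only at *
    rw [abs_of_nonneg (by omega)] at h3 h4
    rw [w2_eq x y B c h6 h7 h3 h4]
    unfold FR
    dsimp only
    congr 2; ring

theorem part_p0 (n : ℕ) (hn : 0 < n) :
    4 * ∑ m ∈ RR n, (if 0 < m.1 ∧ m.2.1 = 0 then FR m else 0) = X0 n := by
  rw [X0, ← Finset.sum_filter, ← Finset.sum_product']
  congr 1
  have e : ∀ q ∈ n.divisorsAntidiagonal ×ˢ Finset.Ico 1 (n + 1),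
      (W6 q.2 q.1.1 q.1.2 * f3 q.2 ≠ 0 → ((q.2 : ℤ) ≤ q.1.1 ∧ (q.2 : ℤ) ≤ q.1.2)) := by
    intro q _ h
    have := W6_ne _ _ _ (left_ne_zero_of_mul h)
    rw [abs_of_nonneg (by omega)] at this
    exact this
  rw [← Finset.sum_filter_of_ne e]
  refine Finset.sum_nbij' (fun m => ((m.2.2.1.toNat, m.2.2.2.toNat), m.1.toNat))
    (fun q => ((q.2 : ℤ), 0, (q.1.1 : ℤ), (q.1.2 : ℤ))) ?_ ?_ ?_ ?_ ?_
  · rintro ⟨x, y, B, c⟩ h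
    rw [Finset.mem_filter, mem_RR] at h
    obtain ⟨⟨h1, h2, h3, h4, h5⟩, h6, h7⟩ := h
    dsimp only at *
    subst h7
    rw [sub_zero, abs_of_nonneg (by omega)] at h3 h4
    lift B to ℕ using h1.le
    lift c to ℕ using h2.le
    lift x to ℕ using h6.le
    have h8 : B * c = n := by
      rw [mul_zero, zero_add] at h5
      exact_mod_cast h5
    have h9 : B ≤ n := by
      rw [← h8]
      exact Nat.le_mul_of_pos_right _ (by omega)
    simp only [Finset.mem_filter, Finset.mem_product, Nat.mem_divisorsAntidiagonal,
      Finset.mem_Ico, Int.toNat_natCast]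
    exact ⟨⟨⟨h8, by omega⟩, by omega, by omega⟩, h3, h4⟩
  · rintro ⟨⟨B, c⟩, x⟩ h
    simp only [Finset.mem_filter, Finset.mem_product, Nat.mem_divisorsAntidiagonal,
      Finset.mem_Ico] at h
    obtain ⟨⟨⟨h1, h2⟩, h3, h4⟩, h5, h6⟩ := h
    rw [Finset.mem_filter, mem_RR]
    dsimp only
    rw [sub_zero, abs_of_nonneg (by omega)]
    refine ⟨⟨by omega, by omega, h5, h6, ?_⟩, by omega, rfl⟩
    rw [← h1]
    push_cast
    ring
  · rintro ⟨x, y, B, c⟩ h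
    rw [Finset.mem_filter, mem_RR] at h
    obtain ⟨⟨h1, h2, h3, h4, h5⟩, h6, h7⟩ := h
    dsimp only at *
    rw [Int.toNat_of_nonneg h1.le, Int.toNat_of_nonneg h2.le, Int.toNat_of_nonneg h6.le, h7]
  · rintro ⟨⟨B, c⟩, x⟩ h
    simp
  · rintro ⟨x, y, B, c⟩ h
    rw [Finset.mem_filter, mem_RR] at h
    obtain ⟨⟨h1, h2, h3, h4, h5⟩, h6, h7⟩ := h
    dsimp only at *
    rw [Int.toNat_of_nonneg h1.le, Int.toNat_of_nonneg h2.le, Int.toNat_of_nonneg h6.le, h7]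
    unfold FR
    simp

theorem sum_E (n : ℕ) (hn : 0 < n) :
    ∑ t ∈ Finset.Icc (-(2 * n) : ℤ) (2 * n), ∑ Q ∈ FN (4 * n - t ^ 2), W6 Q.2.1 Q.1 Q.2.2 * f3 t
      = 2 * ∑ m ∈ PP n, gwZ m.1 m.2.1 m.2.2.1 m.2.2.2 + X0 n := by
  rw [sum_FN_RR]
  have := RR_split n
  rw [part_pp, part_pn, part_p0 n hn] at this
  refine (this : _).trans ?_
  unfold gwZ
  rw [Finset.sum_add_distrib]
  ring

theorem hurw_neg (N : ℤ) (hN : N < 0) : hurwitzClassNumber N = 0 := by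
  unfold hurwitzClassNumber
  rw [if_neg (by omega)]
  have : IsEmpty (FormClasses N) := by
    constructor
    intro c
    induction c using Quot.ind with
    | mk Q =>
      have h1 := Q.2.1
      have h2 := Q.2.2.2
      omega
  exact finsum_of_isEmpty _

theorem FN_empty (N : ℤ) (hN : N ≤ 0) : FN N = ∅ := by
  unfold FN cubeN
  rw [Finset.Icc_eq_empty (by omega)]
  simp

theorem hurw_all (N : ℤ) : 12 * hurwitzClassNumber N
    = ((∑ Q ∈ FN N, W6 Q.2.1 Q.1 Q.2.2 : ℤ) : ℝ) - if N = 0 then 1 else 0 := by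
  rcases lt_trichotomy N 0 with h | h | h
  · rw [hurw_neg N h, FN_empty N h.le, if_neg (by omega)]; simp
  · subst h
    rw [FN_empty 0 le_rfl]
    unfold hurwitzClassNumber
    norm_num
  · rw [hurw_W6 N h, if_neg (by omega), sub_zero]

theorem HH_eq (n : ℕ) : 12 * HH 2 0 3 n =
    ((∑ t ∈ Finset.Icc (-(2 * n) : ℤ) (2 * n), ∑ Q ∈ FN (4 * n - t ^ 2),
      W6 Q.2.1 Q.1 Q.2.2 * f3 t : ℤ) : ℝ)
    - ((∑ t ∈ Finset.Icc (-(2 * n) : ℤ) (2 * n), if 4 * (n : ℤ) - t ^ 2 = 0 then f3 t else 0 : ℤ) : ℝ) := by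
  unfold HH
  rw [finsum_eq_sum_of_support_subset (s := Finset.Icc (-(2 * n) : ℤ) (2 * n))]
  · rw [← Int.cast_sub, ← Finset.sum_sub_distrib, Finset.mul_sum, Int.cast_sum]
    apply Finset.sum_congr rfl
    intro t _
    rw [f3_eq]
    have h := hurw_all (4 * n - t ^ 2)
    rw [← Finset.sum_mul]
    by_cases h3 : t % 3 = 0
    · rw [if_pos (by simpa using h3), if_pos h3]
      rw [mul_left_comm, h]
      push_cast
      split_ifs <;> ring
    · rw [if_neg (by simpa using h3), if_neg h3]
      simp
  · intro t ht
    rw [Function.mem_support] at ht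
    have h1 : ¬ (4 * (n : ℤ) - t ^ 2 < 0) := by
      intro h
      apply ht
      rw [hurw_neg _ h]
      simp
    rw [Finset.coe_Icc, Set.mem_Icc]
    by_cases h0 : n = 0
    · subst h0
      have : t = 0 := by
        have : t ^ 2 ≤ 0 := by push_cast at h1; omega
        nlinarith
      subst this
      simp
    · have h2 : |t| ≤ |2 * (n : ℤ)| := by
        apply sq_le_sq.1
        have : (1 : ℤ) ≤ n := by omega
        nlinarith
      rw [abs_of_nonneg (show 0 ≤ 2 * (n : ℤ) by omega), abs_le] at h2
      exact h2

theorem corner (n : ℕ) (hn : 0 < n) (h3 : 3 ∣ n) :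
    2 * ∑ t ∈ Finset.Icc (-(2 * n) : ℤ) (2 * n), (if 4 * (n : ℤ) - t ^ 2 = 0 then f3 t else 0)
      = ∑ p ∈ n.divisorsAntidiagonal, (if p.1 = p.2 then 16 * (n : ℤ) else 0) := by
  have c : ∀ p ∈ n.divisorsAntidiagonal, (if p.1 = p.2 then 16 * (n : ℤ) else 0)
      = if (p.1 : ℤ) = p.2 then (fun _ => 16 * (n : ℤ)) p.1 else 0 := by
    intro p _
    exact if_congr (by omega) rfl rfl
  rw [Finset.sum_congr rfl c]
  by_cases hs : IsSquare n
  · obtain ⟨q, hq⟩ := hs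
    rw [sum_diag n q hn hq (fun _ => 16 * (n : ℤ))]
    have hq0 : 0 < q := by
      rcases Nat.eq_zero_or_pos q with h | h
      · subst h; omega
      · exact h
    have h3q : 3 ∣ q := by
      rw [hq] at h3
      exact (Nat.Prime.dvd_mul Nat.prime_three).1 h3 |>.elim id id
    have hqn : q ≤ n := by rw [hq]; exact Nat.le_mul_of_pos_left _ hq0
    have hz : (n : ℤ) = q * q := by exact_mod_cast hq
    have hsub : ({2 * (q : ℤ), -(2 * (q : ℤ))} : Finset ℤ) ⊆ Finset.Icc (-(2 * n) : ℤ) (2 * n) := by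
      intro t ht
      simp only [Finset.mem_insert, Finset.mem_singleton] at ht
      rw [Finset.mem_Icc]
      omega
    rw [← Finset.sum_subset hsub]
    · rw [Finset.sum_pair (by omega), if_pos (by rw [hz]; ring), if_pos (by rw [hz]; ring), f3_neg,
        f3_eq, if_pos (by omega), hz]
      ring
    · intro t _ h
      apply if_neg
      intro h'
      apply h
      have : (t - 2 * q) * (t + 2 * q) = 0 := by rw [hz] at h'; linarith
      simp only [Finset.mem_insert, Finset.mem_singleton]
      rcases mul_eq_zero.1 this with h | h
      · left; omega
      · right; omega
  · rw [sum_diag0 n hs (fun _ => 16 * (n : ℤ))]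
    rw [Finset.sum_eq_zero, mul_zero]
    intro t _
    apply if_neg
    intro h'
    apply hs
    have : Even t := by
      by_contra ho
      rw [Int.not_even_iff_odd] at ho
      have := (ho.pow (n := 2))
      rw [show t ^ 2 = 4 * (n : ℤ) by linarith] at this
      rw [← Int.not_even_iff_odd] at this
      exact this ⟨2 * n, by ring⟩
    obtain ⟨u, rfl⟩ := this
    refine ⟨u.natAbs, ?_⟩
    zify
    rw [abs_mul_abs_self]
    linarith

theorem HH_GC (n : ℕ) (hn : 0 < n) (h3 : 3 ∣ n) :
    24 * HH 2 0 3 n = ((∑ p ∈ n.divisorsAntidiagonal, GC p.1 p.2 : ℤ) : ℝ) := by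
  have h1 := HH_eq n
  have h2 := sum_C n hn h3
  have h4 := corner n hn h3
  rw [sum_E n hn] at h1
  rw [Finset.sum_add_distrib] at h2
  have h5 : ∑ p ∈ n.divisorsAntidiagonal, GC p.1 p.2
      = 2 * (2 * ∑ m ∈ PP n, gwZ m.1 m.2.1 m.2.2.1 m.2.2.2 + X0 n)
        - 2 * ∑ t ∈ Finset.Icc (-(2 * n) : ℤ) (2 * n), (if 4 * (n : ℤ) - t ^ 2 = 0 then f3 t else 0) := by
    linarith
  rw [h5, Int.cast_sub, Int.cast_mul, Int.cast_mul]
  push_cast at h1 ⊢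
  linarith

/-- Theorem 1.1 (2), case `m = 0`:
for `3 ∣ n`,
`H_{2,0,3}(n) = -δ_{n=□} n^{3/2} - 54 δ_{9∣n} ∑_{d∣(n/9), d²<n/9} d³`
`+ 2n σ(n/3) - 6n δ_{9∣n} ∑_{d∣(n/9), d²<n/9} d - n^{3/2} δ_{n=□}`. -/
theorem second_moment_m_eq_zero_three_dvd (n : ℕ) (hn : 0 < n) (h3 : 3 ∣ n) :
    HH 2 0 3 n =
      -((if IsSquare n then (1 : ℝ) else 0) * (n : ℝ) ^ ((3 : ℝ) / 2))
      - 54 * (if 9 ∣ n then (1 : ℝ) else 0) *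
          (∑ d ∈ (n / 9).divisors.filter (fun d => d ^ 2 < n / 9), (d : ℝ) ^ 3)
      + 2 * (n : ℝ) * (∑ d ∈ (n / 3).divisors, (d : ℝ))
      - 6 * (n : ℝ) * (if 9 ∣ n then (1 : ℝ) else 0) *
          (∑ d ∈ (n / 9).divisors.filter (fun d => d ^ 2 < n / 9), (d : ℝ))
      - (n : ℝ) ^ ((3 : ℝ) / 2) * (if IsSquare n then (1 : ℝ) else 0) := by
  have h1 := HH_GC n hn h3
  rw [sum_GC n hn h3] at h1
  exact mul_left_cancel₀ (by norm_num : (24 : ℝ) ≠ 0) h1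

end HurwitzPaper
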